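/- arXiv:1802.09938 — 6 statements merged into one kernel-verified Lean document; each statement's English description precedes it below -/
import Mathlib

section
/- For the restricted Yangian Y_p(gl_n) with p > 1, one has the inclusion W_3 ⊆ W^p ∪ W_1 ∪ W_2. -/
open scoped Classical

noncomputable section



/-- The `m × m` matrix `X(u)_m` over `k[u]` attached to a point `x` of `k^{n²p}`:
its `(a,b)` entry is `δ_{ab} u^p + Σ_{t=1}^p x_{ab}^{(t)} u^{p-t}`. -/
def Xu (k : Type*) [CommRing k] (n p : ℕ) (x : Fin n × Fin n × Fin p → k)
    (m : ℕ) (hm : m ≤ n) : Matrix (Fin m) (Fin m) (Polynomial k) :=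
  Matrix.of fun a b =>
    (if (a : ℕ) = (b : ℕ) then Polynomial.X ^ p else 0) +
      ∑ t : Fin p, Polynomial.C (x (Fin.castLE hm a, Fin.castLE hm b, t)) *
        Polynomial.X ^ (p - ((t : ℕ) + 1))

/-- The value at the point `x` of the polynomial `d̄_{mj}`, defined as the coefficient of
`u^{mp-j}` in `det X(u)_m`. -/
def dbar (k : Type*) [CommRing k] (n p : ℕ) (x : Fin n × Fin n × Fin p → k) (m j : ℕ) : k :=
  if hm : m ≤ n then ((Xu k n p x m hm).det).coeff (m * p - j) else 0

/-- The Gelfand–Tsetlin variety for the restricted Yangian `Y_p(gl_n)`: the common zero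
set in `k^{n²p}` of all the polynomials `d̄_{mj}` (`1 ≤ m ≤ n`, `1 ≤ j ≤ mp`). -/
def GTsYang (k : Type*) [CommRing k] (n p : ℕ) : Set (Fin n × Fin n × Fin p → k) :=
  {x | ∀ m j : ℕ, 1 ≤ m → m ≤ n → 1 ≤ j → j ≤ m * p → dbar k n p x m j = 0}




/-- Accessor for the coordinate `X_{ab}^{(t)}` of a point of `k^{n²p}`, with `1`-based
indices `a, b ∈ {1, …, n}` and `t ∈ {1, …, p}` (and value `0` out of range). -/
def xvn (k : Type*) [CommRing k] (n p : ℕ) (x : Fin n × Fin n × Fin p → k) (a b t : ℕ) : k :=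
  if h : 1 ≤ a ∧ a ≤ n ∧ 1 ≤ b ∧ b ≤ n ∧ 1 ≤ t ∧ t ≤ p then
    x (⟨a - 1, by omega⟩, ⟨b - 1, by omega⟩, ⟨t - 1, by omega⟩) else 0

/-- The value of the polynomial `p_{1i} = X_{11}^{(i)}`. -/
def P1v (k : Type*) [CommRing k] (n p : ℕ) (x : Fin n × Fin n × Fin p → k) (i : ℕ) : k :=
  xvn k n p x 1 1 i

/-- The value of the polynomial `p_{2i}` (for `1 ≤ i ≤ 2p`). -/
def P2v (k : Type*) [CommRing k] (n p : ℕ) (x : Fin n × Fin n × Fin p → k) (i : ℕ) : k :=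
  if i ≤ p then
    xvn k n p x 2 2 i - ∑ t ∈ Finset.Icc 1 (i - 1), xvn k n p x 1 2 t * xvn k n p x 2 1 (i - t)
  else
    ∑ t ∈ Finset.Icc (i - p) p, xvn k n p x 1 2 t * xvn k n p x 2 1 (i - t)

/-- The value of
`T(r,s,m) = −X_{13}^{(r)}X_{22}^{(s)}X_{31}^{(m)} + X_{12}^{(r)}X_{23}^{(s)}X_{31}^{(m)}
 + X_{13}^{(r)}X_{21}^{(s)}X_{32}^{(m)}`. -/
def Tv (k : Type*) [CommRing k] (n p : ℕ) (x : Fin n × Fin n × Fin p → k) (r s m : ℕ) : k :=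
  -(xvn k n p x 1 3 r * xvn k n p x 2 2 s * xvn k n p x 3 1 m) +
    xvn k n p x 1 2 r * xvn k n p x 2 3 s * xvn k n p x 3 1 m +
    xvn k n p x 1 3 r * xvn k n p x 2 1 s * xvn k n p x 3 2 m

/-- The value of the polynomial `p_{3i}` (for `1 ≤ i ≤ 3p`). -/
def P3v (k : Type*) [CommRing k] (n p : ℕ) (x : Fin n × Fin n × Fin p → k) (i : ℕ) : k :=
  if i ≤ p then
    xvn k n p x 3 3 i
      - ∑ s ∈ Finset.Icc 1 (i - 1),
          (xvn k n p x 1 3 s * xvn k n p x 3 1 (i - s) +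
           xvn k n p x 2 3 s * xvn k n p x 3 2 (i - s))
      - ∑ r ∈ Finset.Icc 1 (i - 2), ∑ s ∈ Finset.Icc 2 (i - r - 1),
          xvn k n p x 1 3 r * xvn k n p x 2 2 s * xvn k n p x 3 1 (i - r - s)
      + ∑ r ∈ Finset.Icc 1 (i - 2), ∑ s ∈ Finset.Icc 1 (i - r - 1),
          (xvn k n p x 1 2 r * xvn k n p x 2 3 s * xvn k n p x 3 1 (i - r - s) +
           xvn k n p x 1 3 r * xvn k n p x 2 1 s * xvn k n p x 3 2 (i - r - s))
  else if i = p + 1 then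
    - ∑ s ∈ Finset.Icc 1 p,
          (xvn k n p x 1 3 s * xvn k n p x 3 1 (p + 1 - s) +
           xvn k n p x 2 3 s * xvn k n p x 3 2 (p + 1 - s))
      - ∑ r ∈ Finset.Icc 1 (p - 1), ∑ s ∈ Finset.Icc 2 (p - r),
          xvn k n p x 1 3 r * xvn k n p x 2 2 s * xvn k n p x 3 1 (p + 1 - r - s)
      + ∑ r ∈ Finset.Icc 1 (p - 1), ∑ s ∈ Finset.Icc 1 (p - r),
          (xvn k n p x 1 2 r * xvn k n p x 2 3 s * xvn k n p x 3 1 (p + 1 - r - s) +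
           xvn k n p x 1 3 r * xvn k n p x 2 1 s * xvn k n p x 3 2 (p + 1 - r - s))
  else if i ≤ 2 * p then
    - ∑ s ∈ Finset.Icc (i - p) p,
          (xvn k n p x 1 3 s * xvn k n p x 3 1 (i - s) +
           xvn k n p x 2 3 s * xvn k n p x 3 2 (i - s))
      + ∑ r ∈ Finset.Icc 1 (i - p - 1), ∑ s ∈ Finset.Icc (i - p - r) p,
          Tv k n p x r s (i - r - s)
      + ∑ r ∈ Finset.Icc (i - p) p, ∑ s ∈ Finset.Icc 1 (i - r - 1),
          Tv k n p x r s (i - r - s)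
  else
    ∑ r ∈ Finset.Icc (i - 2 * p) p, ∑ s ∈ Finset.Icc (i - p - r) p,
      Tv k n p x r s (i - r - s)


/-- Condition `W`: all the variables `X₁₁^{(t)}, X₁₂^{(t)}, X₂₂^{(t)}` (`1 ≤ t ≤ p`)
vanish at `x`. -/
def WZero (k : Type*) [CommRing k] (n p : ℕ) (x : Fin n × Fin n × Fin p → k) : Prop :=
  ∀ t : ℕ, 1 ≤ t → t ≤ p →
    xvn k n p x 1 1 t = 0 ∧ xvn k n p x 1 2 t = 0 ∧ xvn k n p x 2 2 t = 0

/-- Condition `D`: all the polynomials `p_{mj} = d̄_{mj}` (`4 ≤ m ≤ n`, `1 ≤ j ≤ mp`)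
vanish at `x` (vacuous when `n = 3`). -/
def DZero (k : Type*) [CommRing k] (n p : ℕ) (x : Fin n × Fin n × Fin p → k) : Prop :=
  ∀ m j : ℕ, 4 ≤ m → m ≤ n → 1 ≤ j → j ≤ m * p → dbar k n p x m j = 0

/-- Condition: `p_{3j}` vanishes at `x` for all `1 ≤ j ≤ J`. -/
def P3Zero (k : Type*) [CommRing k] (n p : ℕ) (x : Fin n × Fin n × Fin p → k) (J : ℕ) : Prop :=
  ∀ j : ℕ, 1 ≤ j → j ≤ J → P3v k n p x j = 0

/-- `GTs₁ = Z(W ∪ {p_{3j} : 1 ≤ j ≤ 3p} ∪ D)`. -/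
def GTs1 (k : Type*) [CommRing k] (n p : ℕ) : Set (Fin n × Fin n × Fin p → k) :=
  {x | WZero k n p x ∧ P3Zero k n p x (3 * p) ∧ DZero k n p x}

/-- `W^p = Z(W ∪ {p_{3j} : 1 ≤ j ≤ 3p−3} ∪ {X₃₂^{(p)}, X₂₁^{(p)}, X₁₃^{(p)}} ∪ D)`. -/
def Wtop (k : Type*) [CommRing k] (n p : ℕ) : Set (Fin n × Fin n × Fin p → k) :=
  {x | WZero k n p x ∧ P3Zero k n p x (3 * p - 3) ∧
       xvn k n p x 3 2 p = 0 ∧ xvn k n p x 2 1 p = 0 ∧ xvn k n p x 1 3 p = 0 ∧ DZero k n p x}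

/-- `W_{1s}` (`1 ≤ s ≤ p+1`): the zero set of `W`, `{p_{3j} : 1 ≤ j ≤ 2p}`,
`X₁₃^{(t)}` for `s ≤ t ≤ p`, `X₂₁^{(t)}` for `p−s+2 ≤ t ≤ p`, and `D`.
(For `s = 1` the `X₂₁` conditions are vacuous; for `s = p+1` the `X₁₃` conditions are
vacuous.) -/
def W1s (k : Type*) [CommRing k] (n p s : ℕ) : Set (Fin n × Fin n × Fin p → k) :=
  {x | WZero k n p x ∧ P3Zero k n p x (2 * p) ∧
       (∀ t : ℕ, s ≤ t → t ≤ p → xvn k n p x 1 3 t = 0) ∧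
       (∀ t : ℕ, p + 2 - s ≤ t → t ≤ p → xvn k n p x 2 1 t = 0) ∧ DZero k n p x}

/-- `W₁ = ⋃_{s=1}^{p+1} W_{1s}`. -/
def W1 (k : Type*) [CommRing k] (n p : ℕ) : Set (Fin n × Fin n × Fin p → k) :=
  ⋃ s ∈ Set.Icc 1 (p + 1), W1s k n p s

/-- `W_{2s}` (`2 ≤ s ≤ p+1`): the zero set of `W`, `{p_{3j} : 1 ≤ j ≤ 2p}`,
`X₂₁^{(t)}` for `s ≤ t ≤ p`, `X₃₂^{(t)}` for `p−s+2 ≤ t ≤ p`, and `D`.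
(For `s = p+1` the `X₂₁` conditions are vacuous.) -/
def W2s (k : Type*) [CommRing k] (n p s : ℕ) : Set (Fin n × Fin n × Fin p → k) :=
  {x | WZero k n p x ∧ P3Zero k n p x (2 * p) ∧
       (∀ t : ℕ, s ≤ t → t ≤ p → xvn k n p x 2 1 t = 0) ∧
       (∀ t : ℕ, p + 2 - s ≤ t → t ≤ p → xvn k n p x 3 2 t = 0) ∧ DZero k n p x}

/-- `W₂ = ⋃_{s=2}^{p+1} W_{2s}`. -/
def W2 (k : Type*) [CommRing k] (n p : ℕ) : Set (Fin n × Fin n × Fin p → k) :=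
  ⋃ s ∈ Set.Icc 2 (p + 1), W2s k n p s

/-- `W_{3s}` (`2 ≤ s ≤ p`): the zero set of `W`, `{p_{3j} : 1 ≤ j ≤ 2p}`,
`X₁₃^{(t)}` for `s ≤ t ≤ p`, `X₃₂^{(t)}` for `p−s+2 ≤ t ≤ p`, and `D`. -/
def W3s (k : Type*) [CommRing k] (n p s : ℕ) : Set (Fin n × Fin n × Fin p → k) :=
  {x | WZero k n p x ∧ P3Zero k n p x (2 * p) ∧
       (∀ t : ℕ, s ≤ t → t ≤ p → xvn k n p x 1 3 t = 0) ∧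
       (∀ t : ℕ, p + 2 - s ≤ t → t ≤ p → xvn k n p x 3 2 t = 0) ∧ DZero k n p x}

/-- `W₃ = ⋃_{s=2}^{p} W_{3s}`. -/
def W3 (k : Type*) [CommRing k] (n p : ℕ) : Set (Fin n × Fin n × Fin p → k) :=
  ⋃ s ∈ Set.Icc 2 p, W3s k n p s

theorem W3aux_xz (k : Type*) [Field k] (n p : ℕ) (x : Fin n × Fin n × Fin p → k)
    (a b : ℕ) (h : ∀ t, 1 ≤ t → t ≤ p → xvn k n p x a b t = 0) (t : ℕ) :
    xvn k n p x a b t = 0 := by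
  by_cases ht : 1 ≤ t ∧ t ≤ p
  · exact h t ht.1 ht.2
  · unfold xvn
    rw [dif_neg]
    intro h'
    exact ht ⟨h'.2.2.2.2.1, h'.2.2.2.2.2⟩

theorem W3aux_T (k : Type*) [Field k] (n p : ℕ) (x : Fin n × Fin n × Fin p → k)
    (hW : WZero k n p x) (r s m : ℕ) :
    Tv k n p x r s m = xvn k n p x 1 3 r * xvn k n p x 2 1 s * xvn k n p x 3 2 m := by
  unfold Tv
  rw [W3aux_xz k n p x 1 2 (fun t h1 h2 => (hW t h1 h2).2.1),
    W3aux_xz k n p x 2 2 (fun t h1 h2 => (hW t h1 h2).2.2)]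
  ring

theorem W3aux_ind (k : Type*) [Field k] (n p : ℕ) (hp : 1 < p)
    (x : Fin n × Fin n × Fin p → k) (hW : WZero k n p x) (hP : P3Zero k n p x (2 * p))
    (hD : DZero k n p x) (N : ℕ) : ∀ a d : ℕ, a + d = N → a + d ≤ p →
    (∀ t, a < t → t ≤ p → xvn k n p x 1 3 t = 0) →
    (∀ t, d < t → t ≤ p → xvn k n p x 3 2 t = 0) →
    x ∈ Wtop k n p ∪ W1 k n p ∪ W2 k n p := by
  induction N with
  | zero =>
    intro a d h1 h2 hA hB
    refine Or.inl (Or.inr ?_)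
    refine Set.mem_biUnion (x := 1) ⟨le_rfl, by omega⟩ ?_
    exact ⟨hW, hP, fun t h3 h4 => hA t (by omega) h4, fun t h3 h4 => by omega, hD⟩
  | succ N ih =>
    intro a d h1 h2 hA hB
    have hA' : ∀ t, a < t → xvn k n p x 1 3 t = 0 := by
      intro t ht
      by_cases h : t ≤ p
      · exact hA t ht h
      · unfold xvn
        rw [dif_neg]
        intro h'
        exact h h'.2.2.2.2.2
    have hB' : ∀ t, d < t → xvn k n p x 3 2 t = 0 := by
      intro t ht
      by_cases h : t ≤ p
      · exact hB t ht h
      · unfold xvn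
        rw [dif_neg]
        intro h'
        exact h h'.2.2.2.2.2
    rcases Nat.eq_zero_or_pos a with ha | ha
    · refine Or.inl (Or.inr ?_)
      refine Set.mem_biUnion (x := 1) ⟨le_rfl, by omega⟩ ?_
      exact ⟨hW, hP, fun t h3 h4 => hA t (by omega) h4, fun t h3 h4 => by omega, hD⟩
    rcases Nat.eq_zero_or_pos d with hd | hd
    · refine Or.inr ?_
      refine Set.mem_biUnion (x := p + 1) ⟨by omega, le_rfl⟩ ?_
      exact ⟨hW, hP, fun t h3 h4 => by omega, fun t h3 h4 => hB t (by omega) h4, hD⟩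
    have key : xvn k n p x 1 3 a * xvn k n p x 2 1 p * xvn k n p x 3 2 d = 0 := by
      have h := hP (p + a + d) (by omega) (by omega)
      unfold P3v at h
      rw [if_neg (by omega), if_neg (by omega), if_pos (by omega)] at h
      simp only [W3aux_T k n p x hW] at h
      rw [Finset.sum_eq_zero (s := Finset.Icc (p + a + d - p) p), 
        Finset.sum_eq_zero (s := Finset.Icc (p + a + d - p) p),
        Finset.sum_eq_single a, Finset.sum_eq_single p] at h
      · rw [show p + a + d - a - p = d by omega] at h
        simpa using h
      · intro s hs hne
        rw [Finset.mem_Icc] at hs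
        rw [hB' (p + a + d - a - s) (by omega)]
        ring
      · intro hs
        rw [Finset.mem_Icc] at hs
        omega
      · intro r hr hne
        rw [Finset.mem_Icc] at hr
        refine Finset.sum_eq_zero fun s hs => ?_
        rw [Finset.mem_Icc] at hs
        by_cases hra : a < r
        · rw [hA' r hra]
          ring
        · rw [hB' (p + a + d - r - s) (by omega)]
          ring
      · intro hs
        rw [Finset.mem_Icc] at hs
        omega
      · intro r hr
        rw [Finset.mem_Icc] at hr
        refine Finset.sum_eq_zero fun s hs => ?_
        rw [hA' r (by omega)]
        ring
      · intro s hs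
        rw [Finset.mem_Icc] at hs
        rw [hA' s (by omega), hB' (p + a + d - s) (by omega)]
        ring
    rcases mul_eq_zero.1 key with key | key
    · rcases mul_eq_zero.1 key with key | key
      · refine ih (a - 1) d (by omega) (by omega) ?_ hB
        intro t h3 h4
        rcases Nat.lt_or_ge a t with h | h
        · exact hA t h h4
        · rw [show t = a by omega]
          exact key
      · refine Or.inl (Or.inl ?_)
        refine ⟨hW, ?_, hB' p (by omega), key, hA' p (by omega), hD⟩
        intro j hj1 hj2
        by_cases hj : j ≤ 2 * p
        · exact hP j hj1 hj
        · unfold P3v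
          rw [if_neg (by omega), if_neg (by omega), if_neg (by omega)]
          refine Finset.sum_eq_zero fun r hr => Finset.sum_eq_zero fun s hs => ?_
          rw [Finset.mem_Icc] at hr hs
          rw [W3aux_T k n p x hW]
          by_cases hra : a < r
          · rw [hA' r hra]
            ring
          · rw [hB' (j - r - s) (by omega)]
            ring
    · refine ih a (d - 1) (by omega) (by omega) hA ?_
      intro t h3 h4
      rcases Nat.lt_or_ge d t with h | h
      · exact hB t h h4
      · rw [show t = d by omega]
        exact key

/-- For the restricted Yangian `Y_p(gl_n)` with `p > 1`, one has `W₃ ⊆ W^p ∪ W₁ ∪ W₂`. -/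
theorem W3_subset (k : Type*) [Field k] [IsAlgClosed k] [CharZero k]
    (n p : ℕ) (hn : 3 ≤ n) (hp : 1 < p) :
    W3 k n p ⊆ Wtop k n p ∪ W1 k n p ∪ W2 k n p := by
  intro x hx
  unfold W3 at hx
  simp only [Set.mem_iUnion] at hx
  obtain ⟨s, ⟨hs1, hs2⟩, hW, hP, hA, hB, hD⟩ := hx
  exact W3aux_ind k n p hp x hW hP hD p (s - 1) (p + 1 - s) (by omega) (by omega)
    (fun t h1 h2 => hA t (by omega) h2) (fun t h1 h2 => hB t (by omega) h2)

end
end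

section
/- For the restricted Yangian Y_p(gl_n): if p ∈ {1, 2} then GTs_1 = W_1 ∪ W_2, and if p ≥ 3 then GTs_1 = W^p ∪ W_1 ∪ W_2. -/
open scoped Classical

noncomputable section



theorem aux_xvn_out {k : Type*} [CommRing k] {n p : ℕ} (x : Fin n × Fin n × Fin p → k)
    (a b t : ℕ) (h : ¬ (1 ≤ t ∧ t ≤ p)) : xvn k n p x a b t = 0 := by
  unfold xvn
  rw [dif_neg]
  rintro ⟨_, _, _, _, h1, h2⟩
  exact h ⟨h1, h2⟩

theorem aux_Tv {k : Type*} [CommRing k] {n p : ℕ} {x : Fin n × Fin n × Fin p → k}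
    (hW : WZero k n p x) (r s m : ℕ) :
    Tv k n p x r s m = xvn k n p x 1 3 r * xvn k n p x 2 1 s * xvn k n p x 3 2 m := by
  have h12 : xvn k n p x 1 2 r = 0 := by
    by_cases h : 1 ≤ r ∧ r ≤ p
    · exact (hW r h.1 h.2).2.1
    · exact aux_xvn_out x _ _ _ h
  have h22 : xvn k n p x 2 2 s = 0 := by
    by_cases h : 1 ≤ s ∧ s ≤ p
    · exact (hW s h.1 h.2).2.2
    · exact aux_xvn_out x _ _ _ h
  unfold Tv
  rw [h12, h22]
  ring

theorem aux_P3_top {k : Type*} [CommRing k] {n p : ℕ} {x : Fin n × Fin n × Fin p → k}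
    (hW : WZero k n p x) (hp : 1 ≤ p) (i : ℕ) (hi : 2 * p < i)
    (h : ∀ r s m : ℕ, r ≤ p → s ≤ p → m ≤ p → r + s + m = i →
      xvn k n p x 1 3 r = 0 ∨ xvn k n p x 2 1 s = 0 ∨ xvn k n p x 3 2 m = 0) :
    P3v k n p x i = 0 := by
  unfold P3v
  rw [if_neg (by omega), if_neg (by omega), if_neg (by omega)]
  refine Finset.sum_eq_zero fun r hr => Finset.sum_eq_zero fun s hs => ?_
  rw [Finset.mem_Icc] at hr hs
  rw [aux_Tv hW]
  rcases h r s (i - r - s) (by omega) (by omega) (by omega) (by omega) with h | h | h <;> simp [h]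

theorem aux_P3Zero {k : Type*} [CommRing k] {n p : ℕ} {x : Fin n × Fin n × Fin p → k}
    (hW : WZero k n p x) (hp : 1 ≤ p) (J : ℕ) (hJ : 2 * p ≤ J) (hP : P3Zero k n p x J)
    (h : ∀ r s m : ℕ, r ≤ p → s ≤ p → m ≤ p → J < r + s + m →
      xvn k n p x 1 3 r = 0 ∨ xvn k n p x 2 1 s = 0 ∨ xvn k n p x 3 2 m = 0) :
    P3Zero k n p x (3 * p) := by
  intro j h1 h2
  by_cases hj : j ≤ J
  · exact hP j h1 hj
  · exact aux_P3_top hW hp j (by omega) fun r s m hr hs hm he => h r s m hr hs hm (by omega)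

theorem aux_W_sub {k : Type*} [CommRing k] {n p : ℕ} (hp : 1 ≤ p) :
    W1 k n p ∪ W2 k n p ⊆ GTs1 k n p := by
  rintro x (hx | hx)
  · simp only [W1, Set.mem_iUnion] at hx
    obtain ⟨s0, hs0, hW, hP, ha, hb, hD⟩ := hx
    refine ⟨hW, aux_P3Zero hW hp _ le_rfl hP ?_, hD⟩
    intro r s m hr hs hm hlt
    by_cases h : s0 ≤ r
    · exact Or.inl (ha r h hr)
    · exact Or.inr (Or.inl (hb s (by omega) hs))
  · simp only [W2, Set.mem_iUnion] at hx
    obtain ⟨s0, hs0, hW, hP, ha, hb, hD⟩ := hx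
    refine ⟨hW, aux_P3Zero hW hp _ le_rfl hP ?_, hD⟩
    intro r s m hr hs hm hlt
    by_cases h : s0 ≤ s
    · exact Or.inr (Or.inl (ha s h hs))
    · exact Or.inr (Or.inr (hb m (by omega) hm))

theorem aux_Wtop_sub {k : Type*} [CommRing k] {n p : ℕ} (hp : 3 ≤ p) :
    Wtop k n p ⊆ GTs1 k n p := by
  rintro x ⟨hW, hP, hc, hb, ha, hD⟩
  refine ⟨hW, aux_P3Zero hW (by omega) _ (by omega) hP ?_, hD⟩
  intro r s m hr hs hm hlt
  by_cases h1 : r = p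
  · subst h1; exact Or.inl ha
  by_cases h2 : s = p
  · subst h2; exact Or.inr (Or.inl hb)
  have h3 : m = p := by omega
  subst h3; exact Or.inr (Or.inr hc)

theorem aux_top_deg {k : Type*} [CommRing k] {p : ℕ} (a : ℕ → k)
    (ha : ∀ t, ¬ (1 ≤ t ∧ t ≤ p) → a t = 0) :
    (∀ t, a t = 0) ∨ ∃ d, 1 ≤ d ∧ d ≤ p ∧ a d ≠ 0 ∧ ∀ t, d < t → a t = 0 := by
  by_cases h : ∀ t, a t = 0
  · exact Or.inl h
  right
  push Not at h
  obtain ⟨t, ht⟩ := h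
  have htp : 1 ≤ t ∧ t ≤ p := by by_contra hc; exact ht (ha t hc)
  have hd := Nat.findGreatest_spec (P := fun t => a t ≠ 0) htp.2 ht
  have hd' : 1 ≤ Nat.findGreatest (fun t => a t ≠ 0) p ∧
      Nat.findGreatest (fun t => a t ≠ 0) p ≤ p := by
    by_contra hc; exact hd (ha _ hc)
  refine ⟨_, hd'.1, hd'.2, hd, fun s hs => ?_⟩
  by_cases hsp : s ≤ p
  · by_contra hc
    exact Nat.findGreatest_is_greatest hs hsp hc
  · exact ha s (by omega)

theorem aux_dsum {k : Type*} [CommRing k] {a b c : ℕ → k} {α β γ j : ℕ}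
    (hj : j = α + β + γ)
    (ha : ∀ t, α < t → a t = 0) (hb : ∀ t, β < t → b t = 0) (hc : ∀ t, γ < t → c t = 0)
    (R : Finset ℕ) (S : ℕ → Finset ℕ) (hR : α ∈ R) (hS : β ∈ S α) :
    ∑ r ∈ R, ∑ s ∈ S r, a r * b s * c (j - r - s) = a α * b β * c γ := by
  have key : ∀ r s, ¬ (r = α ∧ s = β) → a r * b s * c (j - r - s) = 0 := by
    intro r s h
    by_cases h1 : α < r
    · simp [ha r h1]
    by_cases h2 : β < s
    · simp [hb s h2]
    have : γ < j - r - s := by omega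
    simp [hc _ this]
  rw [Finset.sum_eq_single α, Finset.sum_eq_single β]
  · congr 2; omega
  · intro s _ hs; exact key _ _ (by tauto)
  · intro h; exact absurd hS h
  · intro r _ hr; exact Finset.sum_eq_zero fun s _ => key _ _ (by tauto)
  · intro h; exact absurd hR h

theorem aux_sub_W {k : Type*} [Field k] {n p : ℕ} (hp : 1 ≤ p) :
    GTs1 k n p ⊆ W1 k n p ∪ W2 k n p := by
  rintro x ⟨hW, hP, hD⟩
  have hP2 : P3Zero k n p x (2 * p) := fun j h1 h2 => hP j h1 (by omega)
  have mk1 : ∀ s, 1 ≤ s → s ≤ p + 1 → (∀ t, s ≤ t → t ≤ p → xvn k n p x 1 3 t = 0) →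
      (∀ t, p + 2 - s ≤ t → t ≤ p → xvn k n p x 2 1 t = 0) → x ∈ W1 k n p ∪ W2 k n p := by
    intro s h1 h2 h3 h4
    left
    simp only [W1, Set.mem_iUnion]
    exact ⟨s, ⟨h1, h2⟩, hW, hP2, h3, h4, hD⟩
  have mk2 : ∀ s, 2 ≤ s → s ≤ p + 1 → (∀ t, s ≤ t → t ≤ p → xvn k n p x 2 1 t = 0) →
      (∀ t, p + 2 - s ≤ t → t ≤ p → xvn k n p x 3 2 t = 0) → x ∈ W1 k n p ∪ W2 k n p := by
    intro s h1 h2 h3 h4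
    right
    simp only [W2, Set.mem_iUnion]
    exact ⟨s, ⟨h1, h2⟩, hW, hP2, h3, h4, hD⟩
  rcases aux_top_deg (p := p) (xvn k n p x 1 3) (fun t h => aux_xvn_out x _ _ t h) with
    h | ⟨α, hα1, hαp, hα, ha⟩
  · exact mk1 1 le_rfl (by omega) (fun t _ _ => h t) (fun t _ _ => by omega)
  rcases aux_top_deg (p := p) (xvn k n p x 2 1) (fun t h => aux_xvn_out x _ _ t h) with
    h | ⟨β, hβ1, hβp, hβ, hb⟩
  · exact mk1 (p + 1) (by omega) (by omega) (fun t _ _ => by omega) (fun t _ _ => h t)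
  rcases aux_top_deg (p := p) (xvn k n p x 3 2) (fun t h => aux_xvn_out x _ _ t h) with
    h | ⟨γ, hγ1, hγp, hγ, hc⟩
  · exact mk2 (p + 1) (by omega) (by omega) (fun t _ _ => by omega) (fun t _ _ => h t)
  by_cases hab : α + β ≤ p
  · exact mk1 (α + 1) (by omega) (by omega) (fun t _ _ => ha t (by omega))
      (fun t _ _ => hb t (by omega))
  by_cases hbc : β + γ ≤ p
  · exact mk2 (β + 1) (by omega) (by omega) (fun t _ _ => hb t (by omega))
      (fun t _ _ => hc t (by omega))
  exfalso
  obtain ⟨j, hj⟩ : ∃ j, j = α + β + γ := ⟨_, rfl⟩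
  have h0 := hP j (by omega) (by omega)
  unfold P3v at h0
  rw [if_neg (by omega), if_neg (by omega)] at h0
  simp only [aux_Tv hW] at h0
  have hne : xvn k n p x 1 3 α * xvn k n p x 2 1 β * xvn k n p x 3 2 γ ≠ 0 :=
    mul_ne_zero (mul_ne_zero hα hβ) hγ
  split_ifs at h0 with h2
  · rw [aux_dsum hj ha hb hc (Finset.Icc 1 (j - p - 1)) (fun r => Finset.Icc (j - p - r) p)
      (Finset.mem_Icc.2 ⟨by omega, by omega⟩)
      (Finset.mem_Icc.2 ⟨by omega, by omega⟩)] at h0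
    rw [Finset.sum_eq_zero, Finset.sum_eq_zero (s := Finset.Icc (j - p) p)] at h0
    · apply hne; simpa using h0
    · intro r hr
      rw [Finset.mem_Icc] at hr
      exact Finset.sum_eq_zero fun s _ => by simp [ha r (by omega)]
    · intro s hs
      rw [Finset.mem_Icc] at hs
      rw [ha s (by omega), hc (j - s) (by omega)]
      simp
  · rw [aux_dsum hj ha hb hc (Finset.Icc (j - 2 * p) p) (fun r => Finset.Icc (j - p - r) p)
      (Finset.mem_Icc.2 ⟨by omega, by omega⟩)
      (Finset.mem_Icc.2 ⟨by omega, by omega⟩)] at h0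
    exact hne h0

/-- Decomposition of the first subvariety `GTs₁` for the restricted Yangian `Y_p(gl_n)`:
`GTs₁ = W₁ ∪ W₂` if `p ∈ {1, 2}`, and `GTs₁ = W^p ∪ W₁ ∪ W₂` if `p ≥ 3`. -/
theorem GTs1_decomposition (k : Type*) [Field k] [IsAlgClosed k] [CharZero k]
    (n p : ℕ) (hn : 3 ≤ n) (hp : 1 ≤ p) :
    (p = 1 ∨ p = 2 → GTs1 k n p = W1 k n p ∪ W2 k n p) ∧
    (3 ≤ p → GTs1 k n p = Wtop k n p ∪ W1 k n p ∪ W2 k n p) := by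
  have h := Set.Subset.antisymm (aux_sub_W (k := k) (n := n) hp) (aux_W_sub hp)
  refine ⟨fun _ => h, fun h3 => ?_⟩
  rw [Set.union_assoc, ← h]
  exact (Set.union_eq_right.2 (aux_Wtop_sub h3)).symm

end
end

section
/- Let A = (a_{rs}^{(t)}) ∈ GTs_1 and let 1 ≤ i ≤ p−2. Then: (1a) if a_{13}^{(t)} = 0 for all t with p−i ≤ t ≤ p, then a_{13}^{(p−i−1)} = 0 or a_{21}^{(p)} = 0 or a_{32}^{(p)} = 0; (1b) if 1 ≤ j ≤ i, a_{13}^{(t)} = 0 for all t with p−i+j ≤ t ≤ p, and a_{21}^{(t)} = 0 for all t with p−j+1 ≤ t ≤ p, then a_{13}^{(p−i+j−1)} = 0 or a_{21}^{(p−j)} = 0 or a_{32}^{(p)} = 0; (1c) if a_{21}^{(t)} = 0 for all t with p−i ≤ t ≤ p, then a_{13}^{(p)} = 0 or a_{21}^{(p−i−1)} = 0 or a_{32}^{(p)} = 0; (2a) if 1 ≤ j ≤ i, a_{21}^{(t)} = 0 for all t with p−i+j ≤ t ≤ p, and a_{32}^{(t)} = 0 for all t with p−j+1 ≤ t ≤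 p, then a_{13}^{(p)} = 0 or a_{21}^{(p−i+j−1)} = 0 or a_{32}^{(p−j)} = 0; (2b) if a_{32}^{(t)} = 0 for all t with p−i ≤ t ≤ p, then a_{13}^{(p)} = 0 or a_{21}^{(p)} = 0 or a_{32}^{(p−i−1)} = 0; (3) if 1 ≤ j ≤ i, a_{13}^{(t)} = 0 for all t with p−i+j ≤ t ≤ p, and a_{32}^{(t)} = 0 for all t with p−j+1 ≤ t ≤ p, then a_{13}^{(p−i+j−1)} = 0 or a_{21}^{(p)} = 0 or a_{32}^{(p−j)} = 0. -/
open scoped Classical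

noncomputable section



theorem key_aux (k : Type*) [Field k] (n p : ℕ)
    (A : Fin n × Fin n × Fin p → k) (hA : A ∈ GTs1 k n p)
    (a b c : ℕ) (ha : a ≤ p) (hb : b ≤ p) (hc : c ≤ p) (hI : 2 * p < a + b + c)
    (h1 : ∀ t : ℕ, a < t → t ≤ p → xvn k n p A 1 3 t = 0)
    (h2 : ∀ t : ℕ, b < t → t ≤ p → xvn k n p A 2 1 t = 0)
    (h3 : ∀ t : ℕ, c < t → t ≤ p → xvn k n p A 3 2 t = 0) :
    xvn k n p A 1 3 a = 0 ∨ xvn k n p A 2 1 b = 0 ∨ xvn k n p A 3 2 c = 0 := by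
  obtain ⟨hW, hP, -⟩ := hA
  have h := hP (a + b + c) (by omega) (by omega)
  unfold P3v at h
  rw [if_neg (by omega), if_neg (by omega), if_neg (by omega)] at h
  have hT : ∀ r s m : ℕ, 1 ≤ r → r ≤ p → 1 ≤ s → s ≤ p → Tv k n p A r s m =
      xvn k n p A 1 3 r * xvn k n p A 2 1 s * xvn k n p A 3 2 m := by
    intro r s m hr hr' hs hs'
    simp [Tv, (hW r hr hr').2.1, (hW s hs hs').2.2]
  rw [Finset.sum_eq_single a, Finset.sum_eq_single b, hT a b _ (by omega) ha (by omega) hb,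
    show a + b + c - a - b = c by omega] at h
  · simpa [or_assoc] using h
  · intro s hs hsb
    rw [Finset.mem_Icc] at hs
    rw [hT a s _ (by omega) ha (by omega) (by omega)]
    rcases lt_or_gt_of_ne hsb with hlt | hlt
    · rw [h3 _ (by omega) (by omega), mul_zero]
    · rw [h2 s hlt hs.2, mul_zero, zero_mul]
  · intro hn
    exact absurd (Finset.mem_Icc.2 ⟨by omega, hb⟩) hn
  · intro r hr hra
    rw [Finset.mem_Icc] at hr
    refine Finset.sum_eq_zero fun s hs => ?_
    rw [Finset.mem_Icc] at hs
    rw [hT r s _ (by omega) hr.2 (by omega) hs.2]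
    rcases lt_or_gt_of_ne hra with hlt | hlt
    · by_cases hsb : b < s
      · rw [h2 s hsb hs.2, mul_zero, zero_mul]
      · rw [h3 _ (by omega) (by omega), mul_zero]
    · rw [h1 r hlt hr.2, zero_mul, zero_mul]
  · intro hn
    exact absurd (Finset.mem_Icc.2 ⟨by omega, ha⟩) hn

/-- The first recursion lemma for points of `GTs₁` (Lemma on vanishing patterns of the
entries `a₁₃^{(t)}, a₂₁^{(t)}, a₃₂^{(t)}` of a point of `GTs₁`). -/
theorem recursion_lemma_one (k : Type*) [Field k] [IsAlgClosed k] [CharZero k]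
    (n p : ℕ) (hn : 3 ≤ n) (hp : 3 ≤ p)
    (A : Fin n × Fin n × Fin p → k) (hA : A ∈ GTs1 k n p)
    (i : ℕ) (hi1 : 1 ≤ i) (hi2 : i ≤ p - 2) :
    ((∀ t : ℕ, p - i ≤ t → t ≤ p → xvn k n p A 1 3 t = 0) →
      xvn k n p A 1 3 (p - i - 1) = 0 ∨ xvn k n p A 2 1 p = 0 ∨ xvn k n p A 3 2 p = 0) ∧
    (∀ j : ℕ, 1 ≤ j → j ≤ i →
      (∀ t : ℕ, p - i + j ≤ t → t ≤ p → xvn k n p A 1 3 t = 0) →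
      (∀ t : ℕ, p - j + 1 ≤ t → t ≤ p → xvn k n p A 2 1 t = 0) →
      xvn k n p A 1 3 (p - i + j - 1) = 0 ∨ xvn k n p A 2 1 (p - j) = 0 ∨
        xvn k n p A 3 2 p = 0) ∧
    ((∀ t : ℕ, p - i ≤ t → t ≤ p → xvn k n p A 2 1 t = 0) →
      xvn k n p A 1 3 p = 0 ∨ xvn k n p A 2 1 (p - i - 1) = 0 ∨ xvn k n p A 3 2 p = 0) ∧
    (∀ j : ℕ, 1 ≤ j → j ≤ i →
      (∀ t : ℕ, p - i + j ≤ t → t ≤ p → xvn k n p A 2 1 t = 0) →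
      (∀ t : ℕ, p - j + 1 ≤ t → t ≤ p → xvn k n p A 3 2 t = 0) →
      xvn k n p A 1 3 p = 0 ∨ xvn k n p A 2 1 (p - i + j - 1) = 0 ∨
        xvn k n p A 3 2 (p - j) = 0) ∧
    ((∀ t : ℕ, p - i ≤ t → t ≤ p → xvn k n p A 3 2 t = 0) →
      xvn k n p A 1 3 p = 0 ∨ xvn k n p A 2 1 p = 0 ∨ xvn k n p A 3 2 (p - i - 1) = 0) ∧
    (∀ j : ℕ, 1 ≤ j → j ≤ i →
      (∀ t : ℕ, p - i + j ≤ t → t ≤ p → xvn k n p A 1 3 t = 0) →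
      (∀ t : ℕ, p - j + 1 ≤ t → t ≤ p → xvn k n p A 3 2 t = 0) →
      xvn k n p A 1 3 (p - i + j - 1) = 0 ∨ xvn k n p A 2 1 p = 0 ∨
        xvn k n p A 3 2 (p - j) = 0) := by
  refine ⟨?_, ?_, ?_, ?_, ?_, ?_⟩
  · intro h
    exact key_aux k n p A hA (p - i - 1) (p) (p) (by omega) (by omega) (by omega) (by omega)
      (fun t ht ht' => by first | omega | exact h t (by omega) ht')
      (fun t ht ht' => by first | omega | exact h t (by omega) ht')
      (fun t ht ht' => by first | omega | exact h t (by omega) ht')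
  · intro j hj hj' h h'
    exact key_aux k n p A hA (p - i + j - 1) (p - j) (p) (by omega) (by omega) (by omega) (by omega)
      (fun t ht ht' => by first | omega | exact h t (by omega) ht' | exact h' t (by omega) ht')
      (fun t ht ht' => by first | omega | exact h t (by omega) ht' | exact h' t (by omega) ht')
      (fun t ht ht' => by first | omega | exact h t (by omega) ht' | exact h' t (by omega) ht')
  · intro h
    exact key_aux k n p A hA (p) (p - i - 1) (p) (by omega) (by omega) (by omega) (by omega)
      (fun t ht ht' => by first | omega | exact h t (by omega) ht')
      (fun t ht ht' => by first | omega | exact h t (by omega) ht')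
      (fun t ht ht' => by first | omega | exact h t (by omega) ht')
  · intro j hj hj' h h'
    exact key_aux k n p A hA (p) (p - i + j - 1) (p - j) (by omega) (by omega) (by omega) (by omega)
      (fun t ht ht' => by first | omega | exact h t (by omega) ht' | exact h' t (by omega) ht')
      (fun t ht ht' => by first | omega | exact h t (by omega) ht' | exact h' t (by omega) ht')
      (fun t ht ht' => by first | omega | exact h t (by omega) ht' | exact h' t (by omega) ht')
  · intro h
    exact key_aux k n p A hA (p) (p) (p - i - 1) (by omega) (by omega) (by omega) (by omega)
      (fun t ht ht' => by first | omega | exact h t (by omega) ht')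
      (fun t ht ht' => by first | omega | exact h t (by omega) ht')
      (fun t ht ht' => by first | omega | exact h t (by omega) ht')
  · intro j hj hj' h h'
    exact key_aux k n p A hA (p - i + j - 1) (p) (p - j) (by omega) (by omega) (by omega) (by omega)
      (fun t ht ht' => by first | omega | exact h t (by omega) ht' | exact h' t (by omega) ht')
      (fun t ht ht' => by first | omega | exact h t (by omega) ht' | exact h' t (by omega) ht')
      (fun t ht ht' => by first | omega | exact h t (by omega) ht' | exact h' t (by omega) ht')

end
end

section
/- Let A = (a_{rs}^{(t)}) ∈ GTs_1, let 2 ≤ s ≤ p−1 and 0 ≤ j ≤ p−s. If a_{13}^{(t)} = 0 for all t with s ≤ t ≤ p and a_{32}^{(m)} = 0 for all m with p−s+2−j ≤ m ≤ p, then a_{13}^{(s−1)} = 0 or a_{21}^{(p)} = 0 or a_{32}^{(p−s+1−j)} = 0. -/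
open scoped Classical

noncomputable section



/-- The second recursion lemma for points of `GTs₁`: if `a₁₃^{(t)} = 0` for `s ≤ t ≤ p`
and `a₃₂^{(m)} = 0` for `p−s+2−j ≤ m ≤ p`, then `a₁₃^{(s−1)} = 0` or `a₂₁^{(p)} = 0` or
`a₃₂^{(p−s+1−j)} = 0`. -/
theorem recursion_lemma_two (k : Type*) [Field k] [IsAlgClosed k] [CharZero k]
    (n p : ℕ) (hn : 3 ≤ n) (hp : 3 ≤ p)
    (A : Fin n × Fin n × Fin p → k) (hA : A ∈ GTs1 k n p)
    (s j : ℕ) (hs1 : 2 ≤ s) (hs2 : s ≤ p - 1) (hj : j ≤ p - s)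
    (h13 : ∀ t : ℕ, s ≤ t → t ≤ p → xvn k n p A 1 3 t = 0)
    (h32 : ∀ m : ℕ, p - s + 2 - j ≤ m → m ≤ p → xvn k n p A 3 2 m = 0) :
    xvn k n p A 1 3 (s - 1) = 0 ∨ xvn k n p A 2 1 p = 0 ∨
      xvn k n p A 3 2 (p - s + 1 - j) = 0 := by
  obtain ⟨hW, hP, -⟩ := hA
  have hT : ∀ r t m : ℕ, 1 ≤ r → r ≤ p → 1 ≤ t → t ≤ p → Tv k n p A r t m =
      xvn k n p A 1 3 r * xvn k n p A 2 1 t * xvn k n p A 3 2 m := by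
    intro r t m h1 h2 h3 h4
    have e1 := (hW r h1 h2).2.1
    have e2 := (hW t h3 h4).2.2
    simp [Tv, e1, e2]
  have key := hP (2 * p - j) (by omega) (by omega)
  unfold P3v at key
  rw [if_neg (by omega), if_neg (by omega), if_pos (by omega)] at key
  have z1 : ∑ t ∈ Finset.Icc (2 * p - j - p) p,
          (xvn k n p A 1 3 t * xvn k n p A 3 1 (2 * p - j - t) +
           xvn k n p A 2 3 t * xvn k n p A 3 2 (2 * p - j - t)) = 0 := by
    refine Finset.sum_eq_zero fun t ht => ?_
    rw [Finset.mem_Icc] at ht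
    rw [h13 t (by omega) (by omega), h32 (2 * p - j - t) (by omega) (by omega)]
    simp
  have z3 : ∑ r ∈ Finset.Icc (2 * p - j - p) p, ∑ t ∈ Finset.Icc 1 (2 * p - j - r - 1),
          Tv k n p A r t (2 * p - j - r - t) = 0 := by
    refine Finset.sum_eq_zero fun r hr => Finset.sum_eq_zero fun t ht => ?_
    rw [Finset.mem_Icc] at hr ht
    rw [hT _ _ _ (by omega) (by omega) (by omega) (by omega), h13 r (by omega) (by omega)]
    simp
  have z2 : ∑ r ∈ Finset.Icc 1 (2 * p - j - p - 1), ∑ t ∈ Finset.Icc (2 * p - j - p - r) p,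
          Tv k n p A r t (2 * p - j - r - t) =
        xvn k n p A 1 3 (s - 1) * xvn k n p A 2 1 p * xvn k n p A 3 2 (p - s + 1 - j) := by
    rw [Finset.sum_eq_single_of_mem (s - 1) (by rw [Finset.mem_Icc]; omega),
      Finset.sum_eq_single_of_mem p (by rw [Finset.mem_Icc]; omega),
      hT _ _ _ (by omega) (by omega) (by omega) (by omega)]
    · congr 2
      omega
    · intro t ht hne
      rw [Finset.mem_Icc] at ht
      rw [hT _ _ _ (by omega) (by omega) (by omega) (by omega), h32 _ (by omega) (by omega)]
      simp
    · intro r hr hne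
      refine Finset.sum_eq_zero fun t ht => ?_
      rw [Finset.mem_Icc] at hr ht
      rw [hT _ _ _ (by omega) (by omega) (by omega) (by omega)]
      rcases Nat.lt_or_ge r s with h | h
      · rw [h32 _ (by omega) (by omega)]
        simp
      · rw [h13 r (by omega) (by omega)]
        simp
  rw [z1, z2, z3] at key
  simpa [or_assoc] using key

end
end

section
/- For the restricted Yangian Y_p(gl_3) with p > 2 and every s with 1 ≤ s ≤ p+1, the subvariety W_{1s} of GTs_1 is equidimensional of dimension 3p, i.e., every irreducible component of W_{1s} has Krull dimension 3p. -/
open scoped Classical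

noncomputable section



/-- The Zariski topology on affine space `σ → k`: generated by complements of
hypersurfaces. -/
def zariskiTopology (k : Type*) [CommRing k] (σ : Type*) : TopologicalSpace (σ → k) :=
  TopologicalSpace.generateFrom
    {U | ∃ f : MvPolynomial σ k, U = {x | MvPolynomial.eval x f ≠ 0}}

/-- The irreducible components of a subset `V` of affine space, with respect to the
subspace topology induced by the Zariski topology. -/
def zComponents (k : Type*) [CommRing k] (σ : Type*) (V : Set (σ → k)) : Set (Set V) :=
  @irreducibleComponents V (TopologicalSpace.induced Subtype.val (zariskiTopology k σ))

/-- The topological Krull dimension of a subset `C` of a subset `V` of affine space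
(with the topology induced from the Zariski topology). -/
def zKrullDimSub (k : Type*) [CommRing k] (σ : Type*) {V : Set (σ → k)} (C : Set V) :
    WithBot ℕ∞ :=
  @topologicalKrullDim C (TopologicalSpace.induced Subtype.val
    (TopologicalSpace.induced Subtype.val (zariskiTopology k σ)))

/-- The topological Krull dimension of a subset of affine space with the Zariski topology. -/
def zKrullDim (k : Type*) [CommRing k] (σ : Type*) (V : Set (σ → k)) : WithBot ℕ∞ :=
  @topologicalKrullDim V (TopologicalSpace.induced Subtype.val (zariskiTopology k σ))

/-- Irreducibility of a subset of affine space with the Zariski topology. -/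
def zIsIrreducible (k : Type*) [CommRing k] (σ : Type*) (V : Set (σ → k)) : Prop :=
  @IsIrreducible _ (zariskiTopology k σ) V

/-- A subset of affine space is equidimensional of dimension `d` if each of its
irreducible components (w.r.t. the Zariski topology) has Krull dimension `d`. -/
def IsEquidimOfDim (k : Type*) [CommRing k] (σ : Type*) (V : Set (σ → k)) (d : ℕ) : Prop :=
  ∀ C ∈ zComponents k σ V, zKrullDimSub k σ C = (d : WithBot ℕ∞)




theorem mvHeight (k : Type*) [Field k] (ι : Type*) [Finite ι] :
    ∀ m : Ideal (MvPolynomial ι k), m.IsMaximal → m.height = Nat.card ι := by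
  induction ι using Finite.induction_empty_option with
  | of_equiv e H =>
    intro m hm
    rw [← Nat.card_congr e]
    have := H (m.comap (MvPolynomial.renameEquiv k e).toRingEquiv)
      (Ideal.comap_isMaximal_of_equiv _)
    rw [← this, RingEquiv.height_comap]
  | h_empty =>
    intro m hm
    have h1 : IsField (MvPolynomial PEmpty k) :=
      (MvPolynomial.isEmptyRingEquiv k PEmpty).toMulEquiv.isField (Field.toIsField k)
    let := h1.toField
    have : m = ⊥ := Ideal.eq_bot_of_prime m
    subst this
    simp
  | h_option IH =>
    rename_i α _
    intro m hm
    let e := (MvPolynomial.optionEquivLeft k α).symm.toRingEquiv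
    have hM : (m.comap e).IsMaximal := Ideal.comap_isMaximal_of_equiv _
    rw [← RingEquiv.height_comap e m]
    have h2 := Polynomial.isMaximal_comap_C_of_isJacobsonRing (m.comap e)
    have h4 : (m.comap e).LiesOver ((m.comap e).comap Polynomial.C) := ⟨rfl⟩
    have h3 := Polynomial.height_eq_height_add_one ((m.comap e).comap Polynomial.C) (m.comap e)
    rw [h3, IH _ h2]
    simp

theorem dim_le_of_gen (k : Type*) [Field k] (σ : Type*) [Finite σ]
    (P : Ideal (MvPolynomial σ k)) [P.IsPrime] (d : ℕ)
    (G : Finset (FractionRing (MvPolynomial σ k ⧸ P))) (hG : G.card ≤ d)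
    (h : ∀ i, algebraMap (MvPolynomial σ k ⧸ P) (FractionRing (MvPolynomial σ k ⧸ P))
      (Ideal.Quotient.mk P (MvPolynomial.X i)) ∈ IntermediateField.adjoin k (G : Set (FractionRing (MvPolynomial σ k ⧸ P)))) :
    ringKrullDim (MvPolynomial σ k ⧸ P) ≤ d := by
  set A := MvPolynomial σ k ⧸ P
  obtain ⟨s, g, gi, gint⟩ := exists_integral_inj_algHom_of_fg k A
  set L := IntermediateField.adjoin k (G : Set (FractionRing A))
  have hA : ∀ a : A, algebraMap A (FractionRing A) a ∈ L := by
    intro a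
    obtain ⟨f, rfl⟩ := Ideal.Quotient.mk_surjective a
    induction f using MvPolynomial.induction_on with
    | C c =>
      have : algebraMap A (FractionRing A) (Ideal.Quotient.mk P (MvPolynomial.C c)) =
        algebraMap k (FractionRing A) c := by
        rw [IsScalarTower.algebraMap_apply k A (FractionRing A)]; rfl
      rw [this]
      exact L.algebraMap_mem c
    | add p q hp hq => rw [map_add, map_add]; exact L.add_mem hp hq
    | mul_X p i hp => rw [map_mul, map_mul]; exact L.mul_mem hp (h i)
  let φ : A →ₐ[k] L := (IsScalarTower.toAlgHom k A (FractionRing A)).codRestrict L.toSubalgebra hA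
  have hφ : Function.Injective φ := by
    intro x y hxy
    have : algebraMap A (FractionRing A) x = algebraMap A (FractionRing A) y :=
      congrArg Subtype.val hxy
    exact IsFractionRing.injective A (FractionRing A) this
  have hs : s ≤ d := by
    have h1 : AlgebraicIndependent k (fun i : Fin s => (φ.comp g) (MvPolynomial.X i)) := by
      have : MvPolynomial.aeval (fun i : Fin s => (φ.comp g) (MvPolynomial.X i)) = φ.comp g := by
        ext i; simp
      rw [AlgebraicIndependent, this]
      exact hφ.comp gi
    have h2 := h1.lift_cardinalMk_le_trdeg
    have h3 : Algebra.trdeg k L ≤ G.card := by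
      let S : Set L := Subtype.val ⁻¹' (G : Set (FractionRing A))
      have : Algebra.IsAlgebraic (Algebra.adjoin k S) L := by
        have h5 : IntermediateField.adjoin k S = ⊤ := by
          have := IntermediateField.lift_injective L
          apply this
          rw [IntermediateField.lift_top, IntermediateField.lift_adjoin]
          congr 1
          ext x
          simp only [S, Set.mem_image, Set.mem_preimage]
          constructor
          · rintro ⟨y, hy, rfl⟩; exact hy
          · intro hx
            exact ⟨⟨x, IntermediateField.subset_adjoin _ _ hx⟩, hx, rfl⟩
        rw [← IntermediateField.isAlgebraic_adjoin_iff_top]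
        rw [h5]
        infer_instance
      refine (Algebra.IsAlgebraic.trdeg_le_cardinalMk k S).trans ?_
      have : Cardinal.mk S ≤ Cardinal.mk (G : Set (FractionRing A)) :=
        Cardinal.mk_preimage_of_injective _ _ Subtype.val_injective
      exact this.trans (by rw [Finset.coe_sort_coe, Cardinal.mk_coe_finset])
    have h4 : (s : Cardinal.{0}) ≤ G.card := by
      have := h2.trans (Cardinal.lift_le.mpr h3)
      simpa using this
    exact (Nat.cast_le.mp h4).trans hG
  have h6 : ringKrullDim A ≤ ringKrullDim (MvPolynomial (Fin s) k) := by
    let := g.toRingHom.toAlgebra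
    have : Algebra.IsIntegral (MvPolynomial (Fin s) k) A := ⟨gint⟩
    refine Order.krullDim_le_of_strictMono (PrimeSpectrum.comap (algebraMap (MvPolynomial (Fin s) k) A)) ?_
    intro I J hIJ
    exact Ideal.IsIntegral.comap_lt_comap (I := I.asIdeal) (J := J.asIdeal) hIJ
  refine h6.trans ?_
  simp
  exact_mod_cast hs

section ZariskiPart

attribute [local instance] zariskiTopology

open MvPolynomial

theorem zInducing (k : Type*) [Field k] (σ : Type*) :
    Topology.IsInducing (pointToPoint : (σ → k) → PrimeSpectrum (MvPolynomial σ k)) := by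
  constructor
  rw [PrimeSpectrum.isTopologicalBasis_basic_opens.eq_generateFrom, induced_generateFrom_eq]
  have : ∀ f : MvPolynomial σ k, {x : σ → k | eval x f ≠ 0} =
      pointToPoint ⁻¹' (PrimeSpectrum.basicOpen f : Set (PrimeSpectrum (MvPolynomial σ k))) := by
    intro f
    ext x
    simp [pointToPoint, aeval_eq_eval]
  unfold zariskiTopology
  congr 1
  ext U
  constructor
  · rintro ⟨f, rfl⟩
    exact ⟨_, ⟨f, rfl⟩, (this f).symm⟩
  · rintro ⟨_, ⟨f, rfl⟩, rfl⟩
    exact ⟨f, (this f).symm⟩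

theorem irred_preimage {X Y : Type*} [TopologicalSpace X] [TopologicalSpace Y] {f : Y → X}
    (hf : Topology.IsInducing f) {Z : Set X} (hZ : IsIrreducible Z) (hr : Z ⊆ Set.range f) :
    IsIrreducible (f ⁻¹' Z) := by
  refine ⟨?_, ?_⟩
  · obtain ⟨z, hz⟩ := hZ.1
    obtain ⟨y, rfl⟩ := hr hz
    exact ⟨y, hz⟩
  · intro u v hu hv ⟨a, ha, hau⟩ ⟨b, hb, hbv⟩
    obtain ⟨u, hu', rfl⟩ := hf.isOpen_iff.mp hu
    obtain ⟨v, hv', rfl⟩ := hf.isOpen_iff.mp hv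
    obtain ⟨z, hz, hzuv⟩ := hZ.2 u v hu' hv' ⟨f a, ha, hau⟩ ⟨f b, hb, hbv⟩
    obtain ⟨y, rfl⟩ := hr hz
    exact ⟨y, hz, hzuv⟩

theorem isClosed_zl (k : Type*) [Field k] (σ : Type*) (I : Ideal (MvPolynomial σ k)) :
    IsClosed (zeroLocus k I) := by
  rw [(zInducing k σ).isClosed_iff]
  refine ⟨PrimeSpectrum.zeroLocus I, PrimeSpectrum.isClosed_zeroLocus _, ?_⟩
  ext x
  simp only [Set.mem_preimage, PrimeSpectrum.mem_zeroLocus, mem_zeroLocus_iff, pointToPoint]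
  constructor
  · intro h p hp
    exact (mem_vanishingIdeal_singleton_iff x p).1 (h hp)
  · intro h p hp
    exact (mem_vanishingIdeal_singleton_iff x p).2 (h p hp)

theorem isIrred_zl (k : Type*) [Field k] [IsAlgClosed k] (σ : Type*) [Finite σ]
    (I : Ideal (MvPolynomial σ k)) [I.IsPrime] :
    IsIrreducible (zeroLocus k I) := by
  have hI : vanishingIdeal k (zeroLocus k I) = I := IsPrime.vanishingIdeal_zeroLocus I
  refine ⟨?_, ?_⟩
  · rw [Set.nonempty_iff_ne_empty]
    intro h
    rw [h, vanishingIdeal_empty] at hI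
    exact Ideal.IsPrime.ne_top ‹_› hI.symm
  · rw [isPreirreducible_iff_isClosed_union_isClosed]
    intro z1 z2 h1 h2 h
    have key : ∀ z : Set (σ → k), IsClosed z → zeroLocus k (vanishingIdeal k z) ⊆ z := by
      intro z hz x hx
      obtain ⟨T, hT, rfl⟩ := (zInducing k σ).isClosed_iff.mp hz
      obtain ⟨J, rfl⟩ := (PrimeSpectrum.isClosed_iff_zeroLocus _).1 hT
      simp only [Set.mem_preimage, PrimeSpectrum.mem_zeroLocus, pointToPoint]
      intro p hp
      refine (mem_vanishingIdeal_singleton_iff x p).2 (hx p ?_)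
      intro y hy
      exact (mem_vanishingIdeal_singleton_iff y p).1 (hy hp)
    have hle : vanishingIdeal k z1 * vanishingIdeal k z2 ≤ I := by
      rw [← hI, Ideal.mul_le]
      intro r hr s hs x hx
      rcases h hx with h | h
      · rw [map_mul, hr x h, zero_mul]
      · rw [map_mul, hs x h, mul_zero]
    rcases (Ideal.IsPrime.mul_le ‹_›).1 hle with h | h
    · left
      exact (zeroLocus_anti_mono h).trans (key _ h1)
    · right
      exact (zeroLocus_anti_mono h).trans (key _ h2)

theorem dim_lower (k : Type*) [Field k] [IsAlgClosed k] (σ : Type*) [Finite σ]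
    (S : Finset (MvPolynomial σ k)) (V : Set (σ → k)) (hV : V = {x | ∀ f ∈ S, eval x f = 0})
    (n : ℕ) (hn : n + S.card ≤ Nat.card σ) (C : Set V) (hC : C ∈ irreducibleComponents V) :
    (n : WithBot ℕ∞) ≤ topologicalKrullDim C := by
  have hN : TopologicalSpace.NoetherianSpace (σ → k) := (zInducing k σ).noetherianSpace
  obtain ⟨o, ho, ⟨x, hxo⟩, hoC⟩ :=
    TopologicalSpace.NoetherianSpace.exists_isOpen_nonempty_subset_irreducibleComponent C hC
  set m : Ideal (MvPolynomial σ k) := vanishingIdeal k {(x : σ → k)} with hm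
  have hmm : m.IsMaximal := inferInstance
  have hSm : (S : Set (MvPolynomial σ k)) ⊆ m := by
    intro f hf
    refine (mem_vanishingIdeal_singleton_iff _ f).2 ?_
    have h1 : (x : σ → k) ∈ {x | ∀ f ∈ S, eval x f = 0} := hV ▸ x.2
    simpa [aeval_eq_eval] using h1 f hf
  have h1 := Ideal.height_le_height_add_encard_of_subset _ hSm
  rw [mvHeight k σ m hmm, Set.encard_coe_eq_coe_finsetCard] at h1
  set I := Ideal.span (S : Set (MvPolynomial σ k))
  have hIm : I ≤ m := Ideal.span_le.2 hSm
  have hp : (m.map (Ideal.Quotient.mk I)).IsPrime := Ideal.isPrime_map_quotientMk_of_isPrime hIm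
  have h2 : (n : ℕ∞) ≤ (m.map (Ideal.Quotient.mk I)).height := by
    have h3 : ((n + S.card : ℕ) : ℕ∞) ≤ (m.map (Ideal.Quotient.mk I)).height + S.card :=
      le_trans (by exact_mod_cast hn) h1
    push_cast at h3
    exact (ENat.add_le_add_iff_right (ENat.natCast_ne_top _)).1 h3
  have h2 : (n : ℕ∞) ≤ Order.height (⟨_, hp⟩ : PrimeSpectrum (MvPolynomial σ k ⧸ I)) := by
    rw [← PrimeSpectrum.height_eq_orderHeight]; exact h2
  obtain ⟨q, hql, hqn⟩ := Order.exists_series_of_le_height _ h2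
  let Q : Fin (q.length + 1) → Ideal (MvPolynomial σ k) :=
    fun i => (q i).asIdeal.comap (Ideal.Quotient.mk I)
  have hQp : ∀ i, (Q i).IsPrime := fun i => Ideal.comap_isPrime _ _
  have hIQ : ∀ i, I ≤ Q i := by
    intro i f hf
    simp only [Q, Ideal.mem_comap]
    rw [Ideal.Quotient.eq_zero_iff_mem.2 hf]
    exact Ideal.zero_mem _
  have hQm : ∀ i, Q i ≤ m := by
    intro i
    have h4 : (q i).asIdeal ≤ m.map (Ideal.Quotient.mk I) := by
      have : q i ≤ RelSeries.last q := q.monotone (Fin.le_last i)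
      rw [hql] at this
      exact this
    refine (Ideal.comap_mono h4).trans ?_
    rw [Ideal.comap_map_of_surjective _ Ideal.Quotient.mk_surjective]
    refine sup_le le_rfl ?_
    rw [← RingHom.ker_eq_comap_bot, Ideal.mk_ker]
    exact hIm
  have hQs : ∀ i j, i < j → ¬ Q j ≤ Q i := by
    intro i j hij h
    have h5 : q i < q j := q.strictMono hij
    refine h5.not_ge ?_
    intro a ha
    obtain ⟨f, rfl⟩ := Ideal.Quotient.mk_surjective a
    exact h ha
  have hZV : ∀ i, zeroLocus k (Q i) ⊆ V := by
    intro i y hy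
    rw [hV]
    intro f hf
    simpa [aeval_eq_eval] using hy f (hIQ i (Ideal.subset_span hf))
  have hxZ : ∀ i, (x : σ → k) ∈ zeroLocus k (Q i) := fun i f hf =>
    (mem_vanishingIdeal_singleton_iff _ f).1 (hQm i hf)
  have hi1 : ∀ i, IsIrreducible ((Subtype.val : V → σ → k) ⁻¹' zeroLocus k (Q i)) := fun i =>
    irred_preimage Topology.IsInducing.subtypeVal (isIrred_zl k σ (Q i)) (by simpa using hZV i)
  have hZC : ∀ i, ((Subtype.val : V → σ → k) ⁻¹' zeroLocus k (Q i)) ⊆ C := by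
    intro i
    refine (subset_closure_inter_of_isPreirreducible_of_isOpen (hi1 i).2 ho ⟨x, hxZ i, hxo⟩).trans ?_
    exact closure_minimal (Set.inter_subset_right.trans hoC) (isClosed_of_mem_irreducibleComponents C hC)
  have hi2 : ∀ i, IsIrreducible ((Subtype.val : C → V) ⁻¹' ((Subtype.val : V → σ → k) ⁻¹' zeroLocus k (Q i))) :=
    fun i => irred_preimage Topology.IsInducing.subtypeVal (hi1 i) (by simpa using hZC i)
  let Z : Fin (q.length + 1) → TopologicalSpace.IrreducibleCloseds C := fun i =>
    ⟨_, hi2 i, ((isClosed_zl k σ (Q i)).preimage continuous_subtype_val).preimage continuous_subtype_val⟩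
  have hmem : ∀ i j, Z i ≤ Z j → ∀ c : C, ((c : V) : σ → k) ∈ zeroLocus k (Q i) →
      ((c : V) : σ → k) ∈ zeroLocus k (Q j) := by
    intro i j h c hc
    have h' : (Z i : Set C) ⊆ Z j := SetLike.coe_subset_coe.2 h
    exact h' hc
  have hZanti : ∀ i j, i < j → Z j < Z i := by
    intro i j hij
    have hle : Q i ≤ Q j := by
      apply Ideal.comap_mono
      exact (q.strictMono hij).le
    refine lt_of_le_not_ge ?_ ?_
    · intro y hy
      exact zeroLocus_anti_mono hle hy
    · intro h
      apply hQs i j hij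
      rw [← IsPrime.vanishingIdeal_zeroLocus (K := k) (Q i), ← IsPrime.vanishingIdeal_zeroLocus (K := k) (Q j)]
      apply vanishingIdeal_anti_mono
      intro y hy
      have hyC : (⟨y, hZV i hy⟩ : V) ∈ C := hZC i hy
      exact hmem i j h ⟨⟨y, hZV i hy⟩, hyC⟩ hy
  let s : LTSeries (TopologicalSpace.IrreducibleCloseds C) :=
    LTSeries.mk q.length (fun i => Z i.rev) (by
      intro i j hij
      exact hZanti _ _ (Fin.rev_lt_rev.2 hij))
  have := Order.LTSeries.length_le_krullDim s
  rw [topologicalKrullDim]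
  have hs : s.length = n := hqn
  rw [← hs]
  exact this

theorem dim_upper (k : Type*) [Field k] (σ : Type*)
    (P : Ideal (MvPolynomial σ k)) {X : Type*} [TopologicalSpace X] (f : X → σ → k)
    (hf : Topology.IsInducing f) (hP : ∀ x, P ≤ vanishingIdeal k {f x}) :
    topologicalKrullDim X ≤ ringKrullDim (MvPolynomial σ k ⧸ P) := by
  have h0 := (zInducing k σ).comp hf
  have h1 : Topology.IsInducing (PrimeSpectrum.comap (Ideal.Quotient.mk P)) :=
    (PrimeSpectrum.isClosedEmbedding_comap_of_surjective _ _ Ideal.Quotient.mk_surjective).isInducing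
  have h2 : ∀ x, ∃ y, PrimeSpectrum.comap (Ideal.Quotient.mk P) y = pointToPoint (f x) := by
    intro x
    have : pointToPoint (f x) ∈ Set.range (PrimeSpectrum.comap (Ideal.Quotient.mk P)) := by
      rw [range_comap_of_surjective _ _ Ideal.Quotient.mk_surjective, Ideal.mk_ker]
      exact hP x
    exact this
  choose g hg using h2
  have h3 : Topology.IsInducing g := by
    rw [← h1.of_comp_iff]
    convert h0 using 1
    funext x
    exact hg x
  rw [← PrimeSpectrum.topologicalKrullDim_eq_ringKrullDim]
  exact h3.topologicalKrullDim_le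

end ZariskiPart

section YangPart

theorem xvn_map {R S : Type*} [CommRing R] [CommRing S] (f : R →+* S) (n p : ℕ)
    (x : Fin n × Fin n × Fin p → R) (a b t : ℕ) :
    xvn S n p (fun i => f (x i)) a b t = f (xvn R n p x a b t) := by
  unfold xvn
  split_ifs <;> simp

theorem Tv_map {R S : Type*} [CommRing R] [CommRing S] (f : R →+* S) (n p : ℕ)
    (x : Fin n × Fin n × Fin p → R) (a b t : ℕ) :
    Tv S n p (fun i => f (x i)) a b t = f (Tv R n p x a b t) := by
  simp [Tv, xvn_map]

theorem P3v_map {R S : Type*} [CommRing R] [CommRing S] (f : R →+* S) (n p : ℕ)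
    (x : Fin n × Fin n × Fin p → R) (j : ℕ) :
    P3v S n p (fun i => f (x i)) j = f (P3v R n p x j) := by
  unfold P3v
  split_ifs <;> simp [Tv_map, xvn_map]

/-- The defining equations of `W1s`. -/
def eqs (k : Type*) [Field k] (p s : ℕ) : Finset (MvPolynomial (Fin 3 × Fin 3 × Fin p) k) :=
  (Finset.Icc 1 p).image (xvn _ 3 p MvPolynomial.X 1 1) ∪
  ((Finset.Icc 1 p).image (xvn _ 3 p MvPolynomial.X 1 2) ∪
  ((Finset.Icc 1 p).image (xvn _ 3 p MvPolynomial.X 2 2) ∪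
  ((Finset.Icc 1 (2 * p)).image (P3v _ 3 p MvPolynomial.X) ∪
  ((Finset.Icc s p).image (xvn _ 3 p MvPolynomial.X 1 3) ∪
  (Finset.Icc (p + 2 - s) p).image (xvn _ 3 p MvPolynomial.X 2 1)))))

theorem eqs_card (k : Type*) [Field k] (p s : ℕ) (hs1 : 1 ≤ s) (hs2 : s ≤ p + 1) :
    (eqs k p s).card ≤ 6 * p := by
  unfold eqs
  refine (Finset.card_union_le _ _).trans ((add_le_add Finset.card_image_le
    ((Finset.card_union_le _ _).trans (add_le_add Finset.card_image_le
    ((Finset.card_union_le _ _).trans (add_le_add Finset.card_image_le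
    ((Finset.card_union_le _ _).trans (add_le_add Finset.card_image_le
    ((Finset.card_union_le _ _).trans (add_le_add Finset.card_image_le
    Finset.card_image_le))))))))).trans ?_)
  simp only [Nat.card_Icc]
  omega

theorem mem_W1s_iff (k : Type*) [Field k] (K : Type*) [Field K] [Algebra k K] (p s : ℕ)
    (hs1 : 1 ≤ s) (hs2 : s ≤ p + 1)
    (x : Fin 3 × Fin 3 × Fin p → K) :
    x ∈ W1s K 3 p s ↔ ∀ f ∈ eqs k p s, MvPolynomial.aeval x f = 0 := by
  have hx : ∀ a b t, MvPolynomial.aeval x (xvn (MvPolynomial (Fin 3 × Fin 3 × Fin p) k) 3 p MvPolynomial.X a b t)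
      = xvn K 3 p x a b t := by
    intro a b t
    have := xvn_map (MvPolynomial.aeval (R := k) x).toRingHom 3 p MvPolynomial.X a b t
    simpa using this.symm
  have hP : ∀ j, MvPolynomial.aeval x (P3v (MvPolynomial (Fin 3 × Fin 3 × Fin p) k) 3 p MvPolynomial.X j)
      = P3v K 3 p x j := by
    intro j
    have := P3v_map (MvPolynomial.aeval (R := k) x).toRingHom 3 p MvPolynomial.X j
    simpa using this.symm
  have hU : ∀ (A B : Finset (MvPolynomial (Fin 3 × Fin 3 × Fin p) k)),
    (∀ f ∈ A ∪ B, MvPolynomial.aeval x f = 0) ↔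
      (∀ f ∈ A, MvPolynomial.aeval x f = 0) ∧ (∀ f ∈ B, MvPolynomial.aeval x f = 0) := by
    intro A B
    exact Finset.forall_mem_union
  unfold eqs
  simp only [hU, Finset.forall_mem_image, hx, hP, Finset.mem_Icc, and_imp]
  unfold W1s WZero P3Zero DZero
  constructor
  · rintro ⟨h1, h2, h3, h4, -⟩
    exact ⟨fun t a b => (h1 t a b).1, fun t a b => (h1 t a b).2.1, fun t a b => (h1 t a b).2.2,
      fun t a b => h2 t a b, fun t a b => h3 t a b, fun t a b => h4 t a b⟩
  · rintro ⟨h1, h2, h3, h4, h5, h6⟩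
    exact ⟨fun t a b => ⟨h1 a b, h2 a b, h3 a b⟩, fun t a b => h4 a b, fun t a b => h5 a b,
      fun t a b => h6 a b, fun m j h h' => by omega⟩

theorem solveL {k K : Type*} [Field k] [Field K] [Algebra k K] (L : IntermediateField k K)
    (γ p : ℕ) (u v w : ℕ → K) (hγ : γ ≠ 0 → u γ ≠ 0) (hγ0 : ∀ t, γ < t → u t = 0)
    (hu : ∀ t, u t ∈ L) (hv0 : ∀ t, p < t → v t = 0) (hv : ∀ t, t ≤ p - γ → v t ∈ L)
    (hw : ∀ j, w j ∈ L)
    (heq : ∀ j, p < j → j ≤ p + γ → ∑ x ∈ Finset.HasAntidiagonal.antidiagonal j, u x.1 * v x.2 + w j = 0) :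
    ∀ t, v t ∈ L := by
  have key : ∀ m t, p + 1 ≤ t + m → v t ∈ L := by
    intro m
    induction m with
    | zero => intro t ht; rw [hv0 t (by omega)]; exact L.zero_mem
    | succ m ih =>
      intro t ht
      by_cases h1 : t ≤ p - γ
      · exact hv t h1
      by_cases h2 : p < t
      · rw [hv0 t h2]; exact L.zero_mem
      have h3 := heq (γ + t) (by omega) (by omega)
      have hmem : (γ, t) ∈ Finset.HasAntidiagonal.antidiagonal (γ + t) := by simp
      rw [← Finset.add_sum_erase _ _ hmem] at h3
      have h4 : ∑ x ∈ (Finset.HasAntidiagonal.antidiagonal (γ + t)).erase (γ, t), u x.1 * v x.2 ∈ L := by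
        refine L.sum_mem ?_
        rintro ⟨r, t'⟩ hx
        simp only [Finset.mem_erase, Finset.HasAntidiagonal.mem_antidiagonal, ne_eq, Prod.mk.injEq, not_and] at hx
        by_cases h5 : γ < r
        · rw [hγ0 r h5, zero_mul]; exact L.zero_mem
        · refine L.mul_mem (hu r) (ih t' ?_)
          have : r ≠ γ := fun h => hx.1 h (by omega)
          omega
      have hne := hγ (by omega)
      have h6 : v t = (u γ)⁻¹ * -(∑ x ∈ (Finset.HasAntidiagonal.antidiagonal (γ + t)).erase (γ, t), u x.1 * v x.2
          + w (γ + t)) := by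
        rw [eq_inv_mul_iff_mul_eq₀ hne]
        linear_combination h3
      rw [h6]
      exact L.mul_mem (L.inv_mem (hu _)) (L.neg_mem (L.add_mem h4 (hw _)))
  intro t
  exact key (p + 1) t (by omega)

theorem xvn_out {K : Type*} [CommRing K] (n p : ℕ) (x : Fin n × Fin n × Fin p → K) (a b t : ℕ)
    (h : t = 0 ∨ p < t) : xvn K n p x a b t = 0 := by
  unfold xvn
  rw [dif_neg]
  omega

theorem conv2 {K : Type*} [CommRing K] (p j lo : ℕ) (f g : ℕ → K)
    (hf : ∀ t, t = 0 ∨ p < t → f t = 0) (hg : ∀ t, t = 0 ∨ p < t → g t = 0)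
    (hj : p < j) (hlo : lo = j - p) :
    ∑ s ∈ Finset.Icc lo p, f s * g (j - s) = ∑ x ∈ Finset.HasAntidiagonal.antidiagonal j, f x.1 * g x.2 := by
  rw [Finset.Nat.sum_antidiagonal_eq_sum_range_succ_mk]
  apply Finset.sum_subset
  · intro t
    simp only [Finset.mem_Icc, Finset.mem_range]
    omega
  · intro t h1 h2
    simp only [Finset.mem_Icc, Finset.mem_range] at h1 h2
    by_cases h : t = 0 ∨ p < t
    · rw [hf t h, zero_mul]
    · rw [hg (j - t) (by omega), mul_zero]

theorem conv3_inner {K : Type*} [CommRing K] (p r j lo hi : ℕ) (f g h : ℕ → K)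
    (hg : ∀ t, t = 0 ∨ p < t → g t = 0)
    (hh : ∀ t, t = 0 ∨ p < t → h t = 0)
    (hhi : hi ≤ j - r)
    (hs : ∀ s, s ≤ j - r → s ≠ 0 → s ≤ p → j - r - s ≠ 0 → j - r - s ≤ p → lo ≤ s ∧ s ≤ hi) :
    ∑ s ∈ Finset.Icc lo hi, f r * g s * h (j - r - s) =
      ∑ s ∈ Finset.range (j - r + 1), f r * g s * h (j - r - s) := by
  apply Finset.sum_subset
  · intro t
    simp only [Finset.mem_Icc, Finset.mem_range]
    omega
  · intro t h1 h2
    simp only [Finset.mem_Icc, Finset.mem_range] at h1 h2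
    by_cases h3 : t = 0 ∨ p < t
    · rw [hg t h3, mul_zero, zero_mul]
    · by_cases h4 : j - r - t = 0 ∨ p < j - r - t
      · rw [hh _ h4, mul_zero]
      · exact absurd (hs t (by omega) (by omega) (by omega) (by omega) (by omega)) h2

theorem P3v_mid {K : Type*} [CommRing K] (p : ℕ) (x : Fin 3 × Fin 3 × Fin p → K)
    (hW : WZero K 3 p x) (j : ℕ) (h1 : p < j) (h2 : j ≤ 2 * p) :
    P3v K 3 p x j =
      -(∑ y ∈ Finset.HasAntidiagonal.antidiagonal j, xvn K 3 p x 1 3 y.1 * xvn K 3 p x 3 1 y.2)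
      - (∑ y ∈ Finset.HasAntidiagonal.antidiagonal j, xvn K 3 p x 2 3 y.1 * xvn K 3 p x 3 2 y.2)
      + ∑ r ∈ Finset.range (j + 1), ∑ s ∈ Finset.range (j - r + 1),
          xvn K 3 p x 1 3 r * xvn K 3 p x 2 1 s * xvn K 3 p x 3 2 (j - r - s) := by
  have h12 : ∀ t, xvn K 3 p x 1 2 t = 0 := fun t => by
    by_cases h : t = 0 ∨ p < t
    · exact xvn_out _ _ _ _ _ _ h
    · exact (hW t (by omega) (by omega)).2.1
  have h22 : ∀ t, xvn K 3 p x 2 2 t = 0 := fun t => by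
    by_cases h : t = 0 ∨ p < t
    · exact xvn_out _ _ _ _ _ _ h
    · exact (hW t (by omega) (by omega)).2.2
  have ho : ∀ a b t, t = 0 ∨ p < t → xvn K 3 p x a b t = 0 := fun a b t h => xvn_out _ _ _ _ _ _ h
  unfold P3v
  rw [if_neg (by omega)]
  simp only [Tv, h12, h22, mul_zero, zero_mul, neg_zero, zero_add, Finset.sum_const_zero, sub_zero,
    Finset.sum_add_distrib]
  split_ifs with h3
  · subst h3
    rw [conv2 p (p+1) 1 _ _ (ho 1 3) (ho 3 1) (by omega) (by omega),
      conv2 p (p+1) 1 _ _ (ho 2 3) (ho 3 2) (by omega) (by omega)]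
    have : ∑ r ∈ Finset.Icc 1 (p - 1), ∑ s ∈ Finset.Icc 1 (p - r),
          xvn K 3 p x 1 3 r * xvn K 3 p x 2 1 s * xvn K 3 p x 3 2 (p + 1 - r - s) =
        ∑ r ∈ Finset.range (p + 1 + 1), ∑ s ∈ Finset.range (p + 1 - r + 1),
          xvn K 3 p x 1 3 r * xvn K 3 p x 2 1 s * xvn K 3 p x 3 2 (p + 1 - r - s) := by
      rw [Finset.sum_congr rfl (fun r hr => conv3_inner p r (p+1) 1 (p - r) _ _ _
        (ho 2 1) (ho 3 2) (by omega) (by omega))]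
      apply Finset.sum_subset
      · intro t
        simp only [Finset.mem_Icc, Finset.mem_range]
        omega
      · intro r hr hr'
        simp only [Finset.mem_Icc, Finset.mem_range] at hr hr'
        by_cases h : r = 0 ∨ p < r
        · simp [ho 1 3 r h]
        · apply Finset.sum_eq_zero
          intro s hs
          simp only [Finset.mem_range] at hs
          by_cases h' : s = 0
          · simp [ho 2 1 s (Or.inl h')]
          · rw [ho 3 2 (p + 1 - r - s) (by omega), mul_zero]
    rw [this]; ring
  · rw [conv2 p j (j-p) _ _ (ho 1 3) (ho 3 1) (by omega) (by omega),
      conv2 p j (j-p) _ _ (ho 2 3) (ho 3 2) (by omega) (by omega)]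
    rw [Finset.sum_congr rfl (fun r hr => conv3_inner p r j (j - p - r) p _ _ _
        (ho 2 1) (ho 3 2) (by simp only [Finset.mem_Icc] at hr; omega) (by omega))]
    rw [Finset.sum_congr (s₁ := Finset.Icc (j - p) p) rfl (fun r hr => conv3_inner p r j 1 (j - r - 1) _ _ _
        (ho 2 1) (ho 3 2) (by omega) (by omega))]
    have hd : Disjoint (Finset.Icc 1 (j - p - 1)) (Finset.Icc (j - p) p) := by
      rw [Finset.disjoint_left]
      intro t
      simp only [Finset.mem_Icc]
      omega
    rw [add_assoc, ← Finset.sum_union hd]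
    have : ∑ r ∈ Finset.Icc 1 (j - p - 1) ∪ Finset.Icc (j - p) p, ∑ s ∈ Finset.range (j - r + 1),
          xvn K 3 p x 1 3 r * xvn K 3 p x 2 1 s * xvn K 3 p x 3 2 (j - r - s) =
        ∑ r ∈ Finset.range (j + 1), ∑ s ∈ Finset.range (j - r + 1),
          xvn K 3 p x 1 3 r * xvn K 3 p x 2 1 s * xvn K 3 p x 3 2 (j - r - s) := by
      apply Finset.sum_subset
      · intro t
        simp only [Finset.mem_Icc, Finset.mem_range, Finset.mem_union]
        omega
      · intro r hr hr'
        simp only [Finset.mem_Icc, Finset.mem_range, Finset.mem_union] at hr hr'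
        have h : r = 0 ∨ p < r := by omega
        simp [ho 1 3 r h]
    rw [this]; ring

theorem conv_assoc {K : Type*} [CommRing K] (j : ℕ) (f g h : ℕ → K) :
    ∑ r ∈ Finset.range (j + 1), ∑ s ∈ Finset.range (j - r + 1), f r * g s * h (j - r - s) =
    ∑ y ∈ Finset.HasAntidiagonal.antidiagonal j, (∑ z ∈ Finset.HasAntidiagonal.antidiagonal y.1, f z.1 * g z.2) * h y.2 := by
  have h1 : PowerSeries.coeff j (PowerSeries.mk f * PowerSeries.mk g * PowerSeries.mk h) =
      ∑ y ∈ Finset.HasAntidiagonal.antidiagonal j, (∑ z ∈ Finset.HasAntidiagonal.antidiagonal y.1, f z.1 * g z.2) * h y.2 := by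
    simp [PowerSeries.coeff_mul]
  have h2 : PowerSeries.coeff j (PowerSeries.mk f * (PowerSeries.mk g * PowerSeries.mk h)) =
      ∑ r ∈ Finset.range (j + 1), ∑ s ∈ Finset.range (j - r + 1), f r * g s * h (j - r - s) := by
    simp only [PowerSeries.coeff_mul, PowerSeries.coeff_mk,
      Finset.Nat.sum_antidiagonal_eq_sum_range_succ_mk, Finset.mul_sum, mul_assoc]
  rw [← h1, ← h2, mul_assoc]

end YangPart


section GenPart

theorem all_mem {k K : Type*} [Field k] [Field K] [Algebra k K] (L : IntermediateField k K)
    (p : ℕ) (x : Fin 3 × Fin 3 × Fin p → K) (hW : WZero K 3 p x) (hP : P3Zero K 3 p x (2 * p))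
    (h13 : ∀ t, xvn K 3 p x 1 3 t ∈ L) (h31 : ∀ t, xvn K 3 p x 3 1 t ∈ L)
    (h23 : ∀ t, xvn K 3 p x 2 3 t ∈ L) (h32 : ∀ t, xvn K 3 p x 3 2 t ∈ L)
    (h21 : ∀ t, xvn K 3 p x 2 1 t ∈ L) (i : Fin 3 × Fin 3 × Fin p) : x i ∈ L := by
  have hW' : ∀ t, xvn K 3 p x 1 1 t = 0 ∧ xvn K 3 p x 1 2 t = 0 ∧ xvn K 3 p x 2 2 t = 0 := by
    intro t
    by_cases h : t = 0 ∨ p < t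
    · exact ⟨xvn_out _ _ _ _ _ _ h, xvn_out _ _ _ _ _ _ h, xvn_out _ _ _ _ _ _ h⟩
    · exact hW t (by omega) (by omega)
  have h11 : ∀ t, xvn K 3 p x 1 1 t ∈ L := fun t => by rw [(hW' t).1]; exact L.zero_mem
  have h12 : ∀ t, xvn K 3 p x 1 2 t ∈ L := fun t => by rw [(hW' t).2.1]; exact L.zero_mem
  have h22 : ∀ t, xvn K 3 p x 2 2 t ∈ L := fun t => by rw [(hW' t).2.2]; exact L.zero_mem
  have h33 : ∀ t, xvn K 3 p x 3 3 t ∈ L := fun t => by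
    by_cases h : t = 0 ∨ p < t
    · rw [xvn_out _ _ _ _ _ _ h]; exact L.zero_mem
    have := hP t (by omega) (by omega)
    unfold P3v at this
    rw [if_pos (by omega)] at this
    rw [add_eq_zero_iff_eq_neg, sub_eq_iff_eq_add, sub_eq_iff_eq_add] at this
    rw [this]
    refine L.add_mem (L.add_mem (L.neg_mem ?_) ?_) ?_
    · exact L.sum_mem fun r _ => L.sum_mem fun s _ => L.add_mem
        (L.mul_mem (L.mul_mem (h12 _) (h23 _)) (h31 _)) (L.mul_mem (L.mul_mem (h13 _) (h21 _)) (h32 _))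
    · exact L.sum_mem fun r _ => L.sum_mem fun s _ =>
        (L.mul_mem (L.mul_mem (h13 _) (h22 _)) (h31 _))
    · exact L.sum_mem fun r _ => L.add_mem
        (L.mul_mem (h13 _) (h31 _)) (L.mul_mem (h23 _) (h32 _))
  obtain ⟨a, b, t⟩ := i
  have hx : x (a, b, t) = xvn K 3 p x (a + 1) (b + 1) (t + 1) := by
    unfold xvn
    rw [dif_pos (by omega)]
    rfl
  rw [hx]
  fin_cases a <;> fin_cases b
  · exact h11 _
  · exact h12 _
  · exact h13 _
  · exact h21 _
  · exact h22 _
  · exact h23 _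
  · exact h31 _
  · exact h32 _
  · exact h33 _

theorem gen_bound (k : Type*) {K : Type*} [Field k] [Field K] [Algebra k K] (p s : ℕ)
    (hs1 : 1 ≤ s) (hs2 : s ≤ p + 1) (x : Fin 3 × Fin 3 × Fin p → K) (hx : x ∈ W1s K 3 p s) :
    ∃ G : Finset K, G.card ≤ 3 * p ∧ ∀ i, x i ∈ IntermediateField.adjoin k (G : Set K) := by
  obtain ⟨hW, hP, hA, hE, -⟩ := hx
  have hmid := P3v_mid p x hW
  have hall := fun L : IntermediateField k K => all_mem L p x hW hP
  have ho : ∀ a b t, t = 0 ∨ p < t → xvn K 3 p x a b t = 0 := fun a b t h => xvn_out _ _ _ _ _ _ h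
  have hoA := ho 1 3
  have hoB := ho 3 1
  have hoC := ho 2 3
  have hoD := ho 3 2
  have hoE := ho 2 1
  generalize xvn K 3 p x 1 3 = a at *
  generalize xvn K 3 p x 3 1 = b at *
  generalize xvn K 3 p x 2 3 = c at *
  generalize xvn K 3 p x 3 2 = d at *
  generalize xvn K 3 p x 2 1 = e at *
  have hA' : ∀ t, s ≤ t → a t = 0 := fun t h => by
    by_cases h' : t ≤ p
    · exact hA t h h'
    · exact hoA t (by omega)
  have hE' : ∀ t, p + 2 - s ≤ t → e t = 0 := fun t h => by
    by_cases h' : t ≤ p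
    · exact hE t h h'
    · exact hoE t (by omega)
  obtain ⟨c', hc'⟩ : ∃ c' : ℕ → K, ∀ t, c' t =
    c t - ∑ z ∈ Finset.HasAntidiagonal.antidiagonal t, a z.1 * e z.2 := ⟨_, fun _ => rfl⟩
  have hc0 : c' 0 = 0 := by
    rw [hc', hoC 0 (Or.inl rfl)]
    simp [hoA 0 (Or.inl rfl)]
  have hcp : ∀ t, p < t → c' t = 0 := by
    intro t ht
    rw [hc', hoC t (Or.inr ht), zero_sub, neg_eq_zero]
    apply Finset.sum_eq_zero
    rintro ⟨r, q⟩ hrq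
    simp only [Finset.HasAntidiagonal.mem_antidiagonal] at hrq
    by_cases h : s ≤ r
    · simp [hA' r h]
    · simp [hE' q (by omega)]
  have heq : ∀ j, p < j → j ≤ 2 * p →
      ∑ y ∈ Finset.HasAntidiagonal.antidiagonal j, a y.1 * b y.2 +
      ∑ y ∈ Finset.HasAntidiagonal.antidiagonal j, c' y.1 * d y.2 = 0 := by
    intro j h1 h2
    have h3 := hmid j h1 h2
    rw [hP j (by omega) h2, conv_assoc] at h3
    simp only [hc', sub_mul, Finset.sum_sub_distrib]
    linear_combination h3
  have hc : ∀ t, c t = c' t + ∑ z ∈ Finset.HasAntidiagonal.antidiagonal t, a z.1 * e z.2 := by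
    intro t; rw [hc']; ring
  -- leading indices
  have hlead : ∀ f : ℕ → K, f 0 = 0 → (∀ t, p < t → f t = 0) →
      ∃ γ ≤ p, (γ ≠ 0 → f γ ≠ 0) ∧ ∀ t, γ < t → f t = 0 := by
    intro f h0 hf
    refine ⟨Nat.findGreatest (fun t => f t ≠ 0) p, Nat.findGreatest_le _, ?_, ?_⟩
    · intro h
      exact Nat.findGreatest_of_ne_zero (P := fun t => f t ≠ 0) rfl h
    · intro t ht
      by_cases htp : t ≤ p
      · have := Nat.findGreatest_is_greatest ht htp
        simpa using this
      · exact hf t (by omega)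
  obtain ⟨γ, hγp, hγ, hγ0⟩ := hlead c' hc0 hcp
  obtain ⟨α, hαp, hα, hα0⟩ := hlead a (hoA 0 (Or.inl rfl)) (fun t h => hoA t (Or.inr h))
  have hsub : ∀ (f : ℕ → K) (m : ℕ) (G : Finset K), f 0 = 0 → (∀ t, m < t → f t = 0) →
      (Finset.Icc 1 m).image f ⊆ G → ∀ t, f t ∈ IntermediateField.adjoin k (G : Set K) := by
    intro f m G h0 hm hG t
    by_cases h : t = 0 ∨ m < t
    · have : f t = 0 := by
        rcases h with h | h
        · rw [h, h0]
        · exact hm t h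
      rw [this]; exact zero_mem _
    · apply IntermediateField.subset_adjoin
      apply hG
      apply Finset.mem_image_of_mem
      simp only [Finset.mem_Icc]; omega
  have hsub' : ∀ (f : ℕ → K) (m : ℕ) (G : Finset K), f 0 = 0 →
      (Finset.Icc 1 m).image f ⊆ G → ∀ t, t ≤ m → f t ∈ IntermediateField.adjoin k (G : Set K) := by
    intro f m G h0 hG t ht
    by_cases h : t = 0
    · rw [h, h0]; exact zero_mem _
    · apply IntermediateField.subset_adjoin
      apply hG
      apply Finset.mem_image_of_mem
      simp only [Finset.mem_Icc]; omega
  have hI : ∀ (f : ℕ → K) (m : ℕ), ((Finset.Icc 1 m).image f).card ≤ m := fun f m =>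
    Finset.card_image_le.trans (by simp)
  have hfin : ∀ L : IntermediateField k K, (∀ t, a t ∈ L) → (∀ t, b t ∈ L) → (∀ t, c' t ∈ L) →
      (∀ t, d t ∈ L) → (∀ t, e t ∈ L) → ∀ i, x i ∈ L := by
    intro L ha hb hcc hd he i
    refine hall L ha hb (fun t => ?_) hd he i
    rw [hc]
    exact L.add_mem (hcc t) (L.sum_mem fun z _ => L.mul_mem (ha _) (he _))
  by_cases hcase : α ≤ γ
  · refine ⟨(Finset.Icc 1 (p + 1 - s)).image e ∪ ((Finset.Icc 1 (s - 1)).image a ∪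
      ((Finset.Icc 1 γ).image c' ∪ ((Finset.Icc 1 p).image b ∪ (Finset.Icc 1 (p - γ)).image d))), ?_, ?_⟩
    · have h1 := Finset.card_union_le ((Finset.Icc 1 (p + 1 - s)).image e) ((Finset.Icc 1 (s - 1)).image a ∪
        ((Finset.Icc 1 γ).image c' ∪ ((Finset.Icc 1 p).image b ∪ (Finset.Icc 1 (p - γ)).image d)))
      have h2 := Finset.card_union_le ((Finset.Icc 1 (s - 1)).image a)
        ((Finset.Icc 1 γ).image c' ∪ ((Finset.Icc 1 p).image b ∪ (Finset.Icc 1 (p - γ)).image d))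
      have h3 := Finset.card_union_le ((Finset.Icc 1 γ).image c')
        ((Finset.Icc 1 p).image b ∪ (Finset.Icc 1 (p - γ)).image d)
      have h4 := Finset.card_union_le ((Finset.Icc 1 p).image b) ((Finset.Icc 1 (p - γ)).image d)
      have := hI e (p + 1 - s)
      have := hI a (s - 1)
      have := hI c' γ
      have := hI b p
      have := hI d (p - γ)
      omega
    · set G := (Finset.Icc 1 (p + 1 - s)).image e ∪ ((Finset.Icc 1 (s - 1)).image a ∪
      ((Finset.Icc 1 γ).image c' ∪ ((Finset.Icc 1 p).image b ∪ (Finset.Icc 1 (p - γ)).image d))) with hG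
      have he := hsub e (p + 1 - s) G (hoE 0 (Or.inl rfl)) (fun t h => hE' t (by omega))
        (by intro y hy; simp only [hG, Finset.mem_union]; tauto)
      have ha := hsub a (s - 1) G (hoA 0 (Or.inl rfl)) (fun t h => hA' t (by omega))
        (by intro y hy; simp only [hG, Finset.mem_union]; tauto)
      have hcc := hsub c' γ G hc0 hγ0
        (by intro y hy; simp only [hG, Finset.mem_union]; tauto)
      have hb := hsub b p G (hoB 0 (Or.inl rfl)) (fun t h => hoB t (Or.inr h))
        (by intro y hy; simp only [hG, Finset.mem_union]; tauto)
      have hd' := hsub' d (p - γ) G (hoD 0 (Or.inl rfl))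
        (by intro y hy; simp only [hG, Finset.mem_union]; tauto)
      have hd := solveL (IntermediateField.adjoin k (G : Set K)) γ p c' d
        (fun j => ∑ y ∈ Finset.HasAntidiagonal.antidiagonal j, a y.1 * b y.2) hγ hγ0 hcc
        (fun t h => hoD t (Or.inr h)) hd'
        (fun j => sum_mem fun z _ => mul_mem (ha _) (hb _))
        (fun j h1 h2 => by rw [add_comm]; exact heq j h1 (by omega))
      exact hfin _ ha hb hcc hd he
  · refine ⟨(Finset.Icc 1 (p + 1 - s)).image e ∪ ((Finset.Icc 1 (s - 1)).image a ∪
      ((Finset.Icc 1 γ).image c' ∪ ((Finset.Icc 1 p).image d ∪ (Finset.Icc 1 (p - α)).image b))), ?_, ?_⟩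
    · have h1 := Finset.card_union_le ((Finset.Icc 1 (p + 1 - s)).image e) ((Finset.Icc 1 (s - 1)).image a ∪
        ((Finset.Icc 1 γ).image c' ∪ ((Finset.Icc 1 p).image d ∪ (Finset.Icc 1 (p - α)).image b)))
      have h2 := Finset.card_union_le ((Finset.Icc 1 (s - 1)).image a)
        ((Finset.Icc 1 γ).image c' ∪ ((Finset.Icc 1 p).image d ∪ (Finset.Icc 1 (p - α)).image b))
      have h3 := Finset.card_union_le ((Finset.Icc 1 γ).image c')
        ((Finset.Icc 1 p).image d ∪ (Finset.Icc 1 (p - α)).image b)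
      have h4 := Finset.card_union_le ((Finset.Icc 1 p).image d) ((Finset.Icc 1 (p - α)).image b)
      have := hI e (p + 1 - s)
      have := hI a (s - 1)
      have := hI c' γ
      have := hI d p
      have := hI b (p - α)
      omega
    · set G := (Finset.Icc 1 (p + 1 - s)).image e ∪ ((Finset.Icc 1 (s - 1)).image a ∪
      ((Finset.Icc 1 γ).image c' ∪ ((Finset.Icc 1 p).image d ∪ (Finset.Icc 1 (p - α)).image b))) with hG
      have he := hsub e (p + 1 - s) G (hoE 0 (Or.inl rfl)) (fun t h => hE' t (by omega))
        (by intro y hy; simp only [hG, Finset.mem_union]; tauto)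
      have ha := hsub a (s - 1) G (hoA 0 (Or.inl rfl)) (fun t h => hA' t (by omega))
        (by intro y hy; simp only [hG, Finset.mem_union]; tauto)
      have hcc := hsub c' γ G hc0 hγ0
        (by intro y hy; simp only [hG, Finset.mem_union]; tauto)
      have hd := hsub d p G (hoD 0 (Or.inl rfl)) (fun t h => hoD t (Or.inr h))
        (by intro y hy; simp only [hG, Finset.mem_union]; tauto)
      have hb' := hsub' b (p - α) G (hoB 0 (Or.inl rfl))
        (by intro y hy; simp only [hG, Finset.mem_union]; tauto)
      have hb := solveL (IntermediateField.adjoin k (G : Set K)) α p a b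
        (fun j => ∑ y ∈ Finset.HasAntidiagonal.antidiagonal j, c' y.1 * d y.2) hα hα0 ha
        (fun t h => hoB t (Or.inr h)) hb'
        (fun j => sum_mem fun z _ => mul_mem (hcc _) (hd _))
        (fun j h1 h2 => heq j h1 (by omega))
      exact hfin _ ha hb hcc hd he

end GenPart

section MainPart

attribute [local instance] zariskiTopology

theorem W1s_aux (k : Type*) [Field k] [IsAlgClosed k]
    (p : ℕ) (s : ℕ) (hs1 : 1 ≤ s) (hs2 : s ≤ p + 1)
    (C : Set (W1s k 3 p s)) (hC : C ∈ irreducibleComponents (W1s k 3 p s)) :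
    topologicalKrullDim C = ((3 * p : ℕ) : WithBot ℕ∞) := by
  have hV : W1s k 3 p s = {x | ∀ f ∈ eqs k p s, MvPolynomial.eval x f = 0} := by
    ext x
    rw [mem_W1s_iff k k p s hs1 hs2]
    simp [MvPolynomial.aeval_eq_eval]
  apply le_antisymm
  · have hCi : IsIrreducible C := hC.1
    have hcont : Continuous (fun x : W1s k 3 p s => MvPolynomial.pointToPoint (x.1 : (Fin 3 × Fin 3 × Fin p) → k)) :=
      ((zInducing k (Fin 3 × Fin 3 × Fin p)).comp Topology.IsInducing.subtypeVal).continuous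
    have h1 := hCi.image _ hcont.continuousOn
    set P := MvPolynomial.vanishingIdeal k ((Subtype.val : W1s k 3 p s → _) '' C) with hPdef
    have h2 : PrimeSpectrum.vanishingIdeal
        ((fun x : W1s k 3 p s => MvPolynomial.pointToPoint (x.1 : (Fin 3 × Fin 3 × Fin p) → k)) '' C) = P := by
      rw [hPdef, ← MvPolynomial.vanishingIdeal_pointToPoint, Set.image_image]
    have hprime : P.IsPrime := by
      rw [← h2]
      exact PrimeSpectrum.isIrreducible_iff_vanishingIdeal_isPrime.1 h1
    let K := FractionRing (MvPolynomial (Fin 3 × Fin 3 × Fin p) k ⧸ P)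
    let ξ : Fin 3 × Fin 3 × Fin p → K := fun i => algebraMap _ K (Ideal.Quotient.mk P (MvPolynomial.X i))
    have hξ : ∀ f : MvPolynomial (Fin 3 × Fin 3 × Fin p) k,
        MvPolynomial.aeval ξ f = algebraMap _ K (Ideal.Quotient.mk P f) := by
      intro f
      have : MvPolynomial.aeval ξ = (IsScalarTower.toAlgHom k
          (MvPolynomial (Fin 3 × Fin 3 × Fin p) k ⧸ P) K).comp (Ideal.Quotient.mkₐ k P) := by
        apply MvPolynomial.algHom_ext
        intro i
        simp [ξ]
      rw [this]
      rfl
    have hmem : ξ ∈ W1s K 3 p s := by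
      rw [mem_W1s_iff k K p s hs1 hs2]
      intro f hf
      rw [hξ]
      have : f ∈ P := by
        rw [hPdef, MvPolynomial.mem_vanishingIdeal_iff]
        rintro _ ⟨y, hy, rfl⟩
        exact (mem_W1s_iff k k p s hs1 hs2 y.1).1 y.2 f hf
      rw [Ideal.Quotient.eq_zero_iff_mem.2 this, map_zero]
    obtain ⟨G, hG, hGm⟩ := gen_bound k p s hs1 hs2 ξ hmem
    refine (dim_upper k _ P (fun c : C => ((c : W1s k 3 p s) : _ → k))
      (Topology.IsInducing.subtypeVal.comp Topology.IsInducing.subtypeVal) ?_).trans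
      (dim_le_of_gen k _ P (3 * p) G hG hGm)
    intro c
    apply MvPolynomial.vanishingIdeal_anti_mono
    rintro _ rfl
    exact ⟨c.1, c.2, rfl⟩
  · refine dim_lower k _ (eqs k p s) _ hV (3 * p) ?_ C hC
    have := eqs_card k p s hs1 hs2
    simp only [Nat.card_eq_fintype_card, Fintype.card_prod, Fintype.card_fin]
    omega

end MainPart

/-- For `Y_p(gl_3)` with `p > 2` and `1 ≤ s ≤ p+1`, the subvariety `W_{1s}` of `GTs₁`
is equidimensional of dimension `3p`. -/
theorem W1s_equidim (k : Type*) [Field k] [IsAlgClosed k] [CharZero k]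
    (p : ℕ) (hp : 2 < p) (s : ℕ) (hs1 : 1 ≤ s) (hs2 : s ≤ p + 1) :
    IsEquidimOfDim k (Fin 3 × Fin 3 × Fin p) (W1s k 3 p s) (3 * p) := by
  intro C hC
  exact W1s_aux k p s hs1 hs2 C hC

end
end

section
/- For the restricted Yangian Y_p(gl_3) with p > 2, the subvariety W_1 := ∪_{s=1}^{p+1} W_{1s} of GTs_1 is equidimensional of dimension 3p, i.e., every irreducible component of W_1 has Krull dimension 3p. -/
open scoped Classical

noncomputable section



attribute [local instance] zariskiTopology

section General

open MvPolynomial TopologicalSpace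

lemma zar_isOpen_D {k : Type*} [Field k] {σ : Type*} (f : MvPolynomial σ k) :
    IsOpen {x : σ → k | eval x f ≠ 0} :=
  TopologicalSpace.isOpen_generateFrom_of_mem ⟨f, rfl⟩

lemma zar_basis (k : Type*) [Field k] (σ : Type*) :
    IsTopologicalBasis {U : Set (σ → k) | ∃ f : MvPolynomial σ k, U = {x | eval x f ≠ 0}} where
  exists_subset_inter := by
    rintro _ ⟨f, rfl⟩ _ ⟨g, rfl⟩ x ⟨hf, hg⟩
    refine ⟨_, ⟨f * g, rfl⟩, ?_, ?_⟩
    · simpa using ⟨hf, hg⟩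
    · intro y hy
      simpa using hy
  sUnion_eq := by
    refine Set.eq_univ_of_forall fun x => ⟨_, ⟨1, rfl⟩, by simp⟩
  eq_generateFrom := rfl

lemma zar_closed_Z {k : Type*} [Field k] {σ : Type*} (f : MvPolynomial σ k) :
    IsClosed {x : σ → k | eval x f = 0} := by
  have := (zar_isOpen_D f).isClosed_compl
  convert this using 1
  ext x; simp

lemma zar_mem_closure {k : Type*} [Field k] {σ : Type*} (S : Set (σ → k)) (x : σ → k) :
    x ∈ closure S ↔ ∀ f : MvPolynomial σ k, (∀ y ∈ S, eval y f = 0) → eval x f = 0 := by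
  rw [(zar_basis k σ).mem_closure_iff]
  constructor
  · intro h f hf
    by_contra hx
    obtain ⟨y, hy1, hy2⟩ := h _ ⟨f, rfl⟩ hx
    exact hy1 (hf y hy2)
  · rintro h _ ⟨f, rfl⟩ hx
    by_contra hne
    refine hx (h f fun y hy => ?_)
    by_contra hy'
    exact hne ⟨y, hy', hy⟩

lemma zar_continuous {k : Type*} [Field k] {σ τ : Type*} (Φ : σ → MvPolynomial τ k) :
    Continuous (fun (w : τ → k) (s : σ) => eval w (Φ s)) := by
  refine continuous_generateFrom_iff.2 ?_
  rintro _ ⟨f, rfl⟩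
  convert zar_isOpen_D (bind₁ Φ f) using 1
  ext w
  simp only [Set.mem_preimage, Set.mem_ofPred_eq]
  rw [← MvPolynomial.coe_aeval_eq_eval w, RingHom.coe_coe, aeval_bind₁]
  simp [aeval_eq_eval]

lemma zar_irred (k : Type*) [Field k] [Infinite k] (τ : Type*) :
    IsIrreducible (Set.univ : Set (τ → k)) := by
  refine ⟨⟨0, trivial⟩, ?_⟩
  rintro u v hu hv ⟨x, -, hx⟩ ⟨y, -, hy⟩
  obtain ⟨_, ⟨f, rfl⟩, hxf, hf⟩ := (zar_basis k τ).exists_subset_of_mem_open hx hu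
  obtain ⟨_, ⟨g, rfl⟩, hyg, hg⟩ := (zar_basis k τ).exists_subset_of_mem_open hy hv
  have hf0 : f ≠ 0 := by rintro rfl; simp at hxf
  have hg0 : g ≠ 0 := by rintro rfl; simp at hyg
  have hfg : f * g ≠ 0 := mul_ne_zero hf0 hg0
  obtain ⟨z, hz⟩ : ∃ z, eval z (f * g) ≠ 0 := by
    by_contra! h
    exact hfg (MvPolynomial.funext (by simpa using h))
  rw [map_mul] at hz
  exact ⟨z, trivial, hf (left_ne_zero_of_mul hz), hg (right_ne_zero_of_mul hz)⟩

lemma ringKrullDim_le_of_subalg {k : Type*} [Field k] {n : ℕ} (A : Type*) [CommRing A]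
    [Algebra k A] [Algebra.FiniteType k A] (f : A →ₐ[k] MvPolynomial (Fin n) k)
    (hf : Function.Injective f) : ringKrullDim A ≤ n := by
  have : Nontrivial A := f.toRingHom.domain_nontrivial
  obtain ⟨s, g, hg, hint⟩ := exists_integral_inj_algHom_of_fg k A
  have hs : s ≤ n := by
    have h1 := lift_trdeg_le_of_injective (f.comp g) (hf.comp hg)
    rw [MvPolynomial.trdeg_of_isDomain, MvPolynomial.trdeg_of_isDomain] at h1
    simpa using h1
  have h2 : ringKrullDim A ≤ ringKrullDim (MvPolynomial (Fin s) k) := by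
    refine Order.krullDim_le_of_strictMono (PrimeSpectrum.comap (g : _ →+* A)) ?_
    intro I J hIJ
    letI := (g : MvPolynomial (Fin s) k →+* A).toAlgebra
    have : Algebra.IsIntegral (MvPolynomial (Fin s) k) A := ⟨hint⟩
    exact Ideal.IsIntegral.comap_lt_comap (I := I.asIdeal) (J := J.asIdeal) hIJ
  refine h2.trans ?_
  rw [MvPolynomial.ringKrullDim_of_isNoetherianRing, ringKrullDim_eq_zero_of_field]
  simpa using hs

lemma dim_upper_s15 {k : Type*} [Field k] [Infinite k] {σ : Type*} [Finite σ] {n : ℕ}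
    (Φ : σ → MvPolynomial (Fin n) k) {Y : Type*} [TopologicalSpace Y] (ι : Y → (σ → k))
    (hι : Topology.IsInducing ι)
    (hY : ∀ y, ι y ∈ closure (Set.range fun (w : Fin n → k) (s : σ) => eval w (Φ s))) :
    topologicalKrullDim Y ≤ n := by
  let F : MvPolynomial σ k →ₐ[k] MvPolynomial (Fin n) k := aeval Φ
  have hF : ∀ w f, eval w (F f) = eval (fun s => eval w (Φ s)) f := by
    intro w f
    rw [← MvPolynomial.coe_aeval_eq_eval w, RingHom.coe_coe]
    change aeval w (bind₁ Φ f) = _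
    rw [aeval_bind₁]
    simp [aeval_eq_eval]
  have hker : ∀ f, F f = 0 → ∀ y, eval (ι y) f = 0 := by
    intro f hf y
    refine (zar_mem_closure _ _).1 (hY y) f ?_
    rintro _ ⟨w, rfl⟩
    rw [← hF, hf, map_zero]
  have : Algebra.FiniteType k F.range :=
    Algebra.FiniteType.of_surjective F.rangeRestrict F.rangeRestrict_surjective
  refine le_trans ?_ (ringKrullDim_le_of_subalg F.range F.range.val Subtype.val_injective)
  have hsurj : Function.Surjective (F.rangeRestrict : MvPolynomial σ k →+* F.range) :=
    F.rangeRestrict_surjective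
  -- the vanishing ideal of a subset
  let I : Set Y → Ideal (MvPolynomial σ k) := fun T =>
    { carrier := {f | ∀ y ∈ T, eval (ι y) f = 0}
      add_mem' := fun {a b} ha hb y hy => by simp [ha y hy, hb y hy]
      zero_mem' := fun y hy => by simp
      smul_mem' := fun c a ha y hy => by simp [ha y hy] }
  have hmemI : ∀ T f, f ∈ I T ↔ ∀ y ∈ T, eval (ι y) f = 0 := fun _ _ => Iff.rfl
  have hprime : ∀ T, IsIrreducible T → (I T).IsPrime := by
    intro T hT
    refine ⟨?_, ?_⟩
    · rw [Ideal.ne_top_iff_one]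
      intro h
      obtain ⟨y, hy⟩ := hT.1
      simpa using h y hy
    · intro f g hfg
      by_contra! h
      obtain ⟨h1, h2⟩ := h
      rw [hmemI] at h1 h2
      push Not at h1 h2
      obtain ⟨x, hx, hxf⟩ := h1
      obtain ⟨y, hy, hyg⟩ := h2
      obtain ⟨z, hz, hz1, hz2⟩ := hT.2 _ _ ((zar_isOpen_D f).preimage hι.continuous)
        ((zar_isOpen_D g).preimage hι.continuous) ⟨x, hx, hxf⟩ ⟨y, hy, hyg⟩
      have := hfg z hz
      rw [map_mul] at this
      exact (mul_ne_zero hz1 hz2) this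
  have hker' : ∀ T, RingHom.ker (F.rangeRestrict : MvPolynomial σ k →+* F.range) ≤ I T := by
    intro T f hf y _
    refine hker f ?_ y
    have := congrArg Subtype.val hf
    simpa using this
  have hclosed : ∀ T : Set Y, IsClosed T → ∀ y, (∀ f ∈ I T, eval (ι y) f = 0) → y ∈ T := by
    intro T hT y hy
    rw [← hT.closure_eq, hι.closure_eq_preimage_closure_image]
    refine (zar_mem_closure _ _).2 ?_
    intro f hf
    exact hy f fun z hz => hf _ ⟨z, hz, rfl⟩
  rw [topologicalKrullDim, ← Order.krullDim_orderDual]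
  let G : (IrreducibleCloseds Y)ᵒᵈ → PrimeSpectrum F.range := fun T =>
    ⟨Ideal.map (F.rangeRestrict : MvPolynomial σ k →+* F.range) (I (OrderDual.ofDual T : IrreducibleCloseds Y)),
      by
        have := hprime _ (OrderDual.ofDual T).isIrreducible'
        exact Ideal.map_isPrime_of_surjective hsurj (hker' _)⟩
  refine Order.krullDim_le_of_strictMono G ?_
  have hcm : ∀ T, Ideal.comap (F.rangeRestrict : MvPolynomial σ k →+* F.range)
      (Ideal.map (F.rangeRestrict : MvPolynomial σ k →+* F.range) (I T)) = I T := by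
    intro T
    rw [Ideal.comap_map_of_surjective' _ hsurj]
    exact sup_eq_left.2 (hker' T)
  intro T₁ T₂ h
  have h' : (OrderDual.ofDual T₂ : IrreducibleCloseds Y) < OrderDual.ofDual T₁ := h
  have hle : ((OrderDual.ofDual T₂ : IrreducibleCloseds Y) : Set Y) ⊆ (OrderDual.ofDual T₁ : IrreducibleCloseds Y) := h'.le
  have hIle : I (OrderDual.ofDual T₁ : IrreducibleCloseds Y) ≤ I (OrderDual.ofDual T₂ : IrreducibleCloseds Y) :=
    fun f hf y hy => hf y (hle hy)
  refine lt_of_le_of_ne (Ideal.map_mono hIle) ?_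
  intro heq
  have heq' := congrArg (fun P => Ideal.comap (F.rangeRestrict : MvPolynomial σ k →+* F.range)
    (PrimeSpectrum.asIdeal P)) heq
  simp only [G, hcm] at heq'
  refine h'.not_ge ?_
  intro y hy
  refine hclosed _ (OrderDual.ofDual T₂).isClosed' y ?_
  intro f hf
  have hf' : f ∈ I (OrderDual.ofDual T₁ : IrreducibleCloseds Y) := by
    rw [heq']; exact hf
  exact hf' y hy

lemma dim_lower_s15 {k : Type*} [Field k] [Infinite k] {σ : Type*} {n : ℕ}
    {Y : Type*} [TopologicalSpace Y] (ι : Y → (σ → k)) (hι : Continuous ι)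
    (ψ : (Fin n → k) → Y) (hψ : Continuous ψ)
    (hchain : ∀ i : Fin n, ∃ s : σ, ∃ c d : k, d ≠ 0 ∧
      ∀ w : Fin n → k, (∀ l, i < l → w l = 0) → ι (ψ w) s = c + d * w i) :
    (n : WithBot ℕ∞) ≤ topologicalKrullDim Y := by
  let π : ℕ → (Fin n → k) → (Fin n → k) := fun i w l => if (l : ℕ) < i then w l else 0
  have hπ : ∀ i, Continuous (π i) := by
    intro i
    convert zar_continuous (k := k) (fun l : Fin n => if (l : ℕ) < i then (X l : MvPolynomial (Fin n) k) else 0) using 1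
    ext w l
    simp only [π]
    split_ifs <;> simp
  let T : ℕ → IrreducibleCloseds Y := fun i =>
    ⟨closure (Set.range (ψ ∘ π i)), by
      rw [isIrreducible_iff_closure, ← Set.image_univ]
      exact (zar_irred k (Fin n)).image _ (hψ.comp (hπ i)).continuousOn, isClosed_closure⟩
  have hT : ∀ i : Fin n, T i < T (i + 1) := by
    intro i
    have hle : T i ≤ T (i + 1) := by
      refine closure_mono ?_
      rintro _ ⟨w, rfl⟩
      refine ⟨π i w, ?_⟩
      simp only [Function.comp]
      congr 1
      ext l
      simp only [π]
      split_ifs <;> first | rfl | omega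
    refine lt_of_le_not_ge hle ?_
    intro hge
    obtain ⟨s, c, d, hd, h⟩ := hchain i
    have hy : ψ (Pi.single i 1) ∈ T (i + 1) := by
      refine subset_closure ⟨Pi.single i 1, ?_⟩
      simp only [Function.comp]
      congr 1
      ext l
      simp only [π]
      split_ifs with hl
      · rfl
      · rw [Pi.single_eq_of_ne]
        rintro rfl; omega
    have hy2 : ψ (Pi.single i 1) ∈ closure (Set.range (ψ ∘ π i)) := hge hy
    have hcl : IsClosed {y : Y | ι y s = c} := by
      have := (zar_closed_Z (X s - C c : MvPolynomial σ k)).preimage hι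
      convert this using 1
      ext y; simp [sub_eq_zero]
    have hsub : closure (Set.range (ψ ∘ π i)) ⊆ {y : Y | ι y s = c} := by
      refine closure_minimal ?_ hcl
      rintro _ ⟨w, rfl⟩
      simp only [Function.comp, Set.mem_ofPred_eq]
      rw [h]
      · simp [π]
      · intro l hl
        simp only [π]
        rw [if_neg]
        have : (i : ℕ) < l := hl
        omega
    have h3 := hsub hy2
    simp only [Set.mem_ofPred_eq] at h3
    rw [h] at h3
    · simp [hd] at h3
    · intro l hl
      exact Pi.single_eq_of_ne hl.ne' _
  exact Order.le_krullDim_iff.2 ⟨⟨n, fun i => T i, fun i => by simpa using hT i⟩, rfl⟩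

theorem equidim_of_param {k : Type*} [Field k] [Infinite k] {σ : Type*} [Finite σ]
    (V : Set (σ → k)) (n : ℕ) {J : Type*} [Finite J]
    (Φ : J → σ → MvPolynomial (Fin n) k)
    (himg : ∀ j w, (fun s => eval w (Φ j s)) ∈ V)
    (hcov : ∀ x ∈ V, ∃ j w, (fun s => eval w (Φ j s)) = x)
    (hchain : ∀ j, ∀ i : Fin n, ∃ s : σ, ∃ c d : k, d ≠ 0 ∧
      ∀ w : Fin n → k, (∀ l, i < l → w l = 0) → eval w (Φ j s) = c + d * w i) :
    IsEquidimOfDim k σ V n := by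
  intro C hC
  let ψ : J → (Fin n → k) → V := fun j w => ⟨fun s => eval w (Φ j s), himg j w⟩
  have hψ : ∀ j, Continuous (ψ j) := fun j =>
    Continuous.subtype_mk (zar_continuous (Φ j)) _
  let Z : J → Set V := fun j => closure (Set.range (ψ j))
  have hZ : ∀ j, IsIrreducible (Z j) := by
    intro j
    rw [isIrreducible_iff_closure, ← Set.image_univ]
    exact (zar_irred k (Fin n)).image _ (hψ j).continuousOn
  have hC' : C ∈ irreducibleComponents V := hC
  obtain ⟨j, hj⟩ : ∃ j, C ⊆ Z j := by
    have := (isIrreducible_iff_sUnion_isClosed.1 hC'.1) (Set.finite_range Z).toFinset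
      (by
        intro z hz
        simp only [Set.Finite.mem_toFinset] at hz
        obtain ⟨j, rfl⟩ := hz
        exact isClosed_closure)
      (by
        intro x hx
        obtain ⟨j, w, hw⟩ := hcov x.1 x.2
        refine Set.mem_sUnion.2 ⟨Z j, by simp, subset_closure ⟨w, Subtype.ext hw⟩⟩)
    obtain ⟨z, hz, hCz⟩ := this
    simp only [Set.Finite.mem_toFinset] at hz
    obtain ⟨j, rfl⟩ := hz
    exact ⟨j, hCz⟩
  have hCj : C = Z j := Set.Subset.antisymm hj (hC'.2 (hZ j) hj)
  subst hCj
  change topologicalKrullDim (Z j) = n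
  have hind : Topology.IsInducing (fun y : Z j => ((y : V) : σ → k)) :=
    (Topology.IsInducing.subtypeVal (t := V)).comp Topology.IsInducing.subtypeVal
  refine le_antisymm ?_ ?_
  · refine dim_upper_s15 (Φ j) _ hind ?_
    intro y
    have := image_closure_subset_closure_image (s := Set.range (ψ j)) (continuous_subtype_val (p := fun x => x ∈ V)) ⟨y.1, y.2, rfl⟩
    rw [← Set.range_comp] at this
    exact this
  · exact dim_lower_s15 _ hind.continuous (fun w => ⟨ψ j w, subset_closure ⟨w, rfl⟩⟩)
      (Continuous.subtype_mk (hψ j) _) (hchain j)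

end General

section Specific

open PowerSeries

lemma conv2_s15 {k : Type*} [Field k] (f g : ℕ → k) (i : ℕ) (S : Finset ℕ)
    (hS : ∀ r ∈ S, r ≤ i) (h : ∀ r ≤ i, r ∉ S → f r * g (i - r) = 0) :
    ∑ r ∈ S, f r * g (i - r) = coeff i (mk f * mk g) := by
  rw [coeff_mul, Finset.Nat.sum_antidiagonal_eq_sum_range_succ_mk]
  simp only [coeff_mk]
  refine Finset.sum_subset ?_ ?_
  · intro r hr
    have := hS r hr
    simp; omega
  · intro r hr hr'
    refine h r ?_ hr'
    simp at hr; omega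

lemma conv3 {k : Type*} [Field k] (f g h : ℕ → k) (i : ℕ) (S : Finset ℕ) (T : ℕ → Finset ℕ)
    (hS : ∀ r ∈ S, ∀ s ∈ T r, r + s ≤ i)
    (h0 : ∀ r s, r + s ≤ i → (r ∈ S → s ∉ T r) → f r * g s * h (i - r - s) = 0) :
    ∑ r ∈ S, ∑ s ∈ T r, f r * g s * h (i - r - s) = coeff i (mk f * mk g * mk h) := by
  rw [mul_assoc, coeff_mul, Finset.Nat.sum_antidiagonal_eq_sum_range_succ_mk]
  simp only [coeff_mul, Finset.Nat.sum_antidiagonal_eq_sum_range_succ_mk, coeff_mk, Finset.mul_sum,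
    ← mul_assoc]
  rw [Finset.sum_sigma', Finset.sum_sigma']
  refine Finset.sum_subset ?_ ?_
  · rintro ⟨r, s⟩ hr
    simp only [Finset.mem_sigma, Finset.mem_range] at hr ⊢
    have := hS r hr.1 s hr.2
    omega
  · rintro ⟨r, s⟩ hr hr'
    simp only [Finset.mem_sigma, Finset.mem_range, not_and] at hr hr'
    exact h0 r s (by omega) hr'

lemma xvn_zero {k : Type*} [Field k] {n p : ℕ} (x : Fin n × Fin n × Fin p → k) (a b t : ℕ)
    (h : t = 0 ∨ p < t) : xvn k n p x a b t = 0 := by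
  rw [xvn, dif_neg]
  omega

lemma P3v_eq {k : Type*} [Field k] {p : ℕ} (hp : 2 < p) (x : Fin 3 × Fin 3 × Fin p → k)
    (hW : WZero k 3 p x) (i : ℕ) (hi : 1 ≤ i) (hi2 : i ≤ 2 * p) :
    P3v k 3 p x i = xvn k 3 p x 3 3 i +
      coeff i (mk (xvn k 3 p x 1 3) * mk (xvn k 3 p x 2 1) * mk (xvn k 3 p x 3 2)
        - mk (xvn k 3 p x 1 3) * mk (xvn k 3 p x 3 1)
        - mk (xvn k 3 p x 2 3) * mk (xvn k 3 p x 3 2)) := by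
  have h12 : ∀ t, xvn k 3 p x 1 2 t = 0 := by
    intro t
    by_cases h : 1 ≤ t ∧ t ≤ p
    · exact (hW t h.1 h.2).2.1
    · exact xvn_zero _ _ _ _ (by omega)
  have h22 : ∀ t, xvn k 3 p x 2 2 t = 0 := by
    intro t
    by_cases h : 1 ≤ t ∧ t ≤ p
    · exact (hW t h.1 h.2).2.2
    · exact xvn_zero _ _ _ _ (by omega)
  have ha : ∀ t, (t = 0 ∨ p < t) → xvn k 3 p x 1 3 t = 0 := xvn_zero x 1 3
  have hb : ∀ t, (t = 0 ∨ p < t) → xvn k 3 p x 2 1 t = 0 := xvn_zero x 2 1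
  have hc : ∀ t, (t = 0 ∨ p < t) → xvn k 3 p x 2 3 t = 0 := xvn_zero x 2 3
  have hd : ∀ t, (t = 0 ∨ p < t) → xvn k 3 p x 3 1 t = 0 := xvn_zero x 3 1
  have he : ∀ t, (t = 0 ∨ p < t) → xvn k 3 p x 3 2 t = 0 := xvn_zero x 3 2
  have hf : ∀ t, (t = 0 ∨ p < t) → xvn k 3 p x 3 3 t = 0 := xvn_zero x 3 3
  simp only [P3v, Tv, h12, h22]
  generalize xvn k 3 p x 1 3 = a at *
  generalize xvn k 3 p x 2 1 = b at *
  generalize xvn k 3 p x 2 3 = c at *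
  generalize xvn k 3 p x 3 1 = d at *
  generalize xvn k 3 p x 3 2 = e at *
  generalize xvn k 3 p x 3 3 = f at *
  simp only [mul_zero, zero_mul, neg_zero, zero_add, Finset.sum_const_zero, sub_zero, map_sub,
    Finset.sum_add_distrib]
  have z2 : ∀ (f g : ℕ → k), (∀ t, (t = 0 ∨ p < t) → f t = 0) → (∀ t, (t = 0 ∨ p < t) → g t = 0) →
      ∀ r q, (r = 0 ∨ p < r ∨ q = 0 ∨ p < q) → f r * g q = 0 := by
    intro f g hf hg r q h
    by_cases h1 : r = 0 ∨ p < r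
    · rw [hf r h1, zero_mul]
    · rw [hg q (by omega), mul_zero]
  have z3 : ∀ r s q, (r = 0 ∨ p < r ∨ s = 0 ∨ p < s ∨ q = 0 ∨ p < q) → a r * b s * e q = 0 := by
    intro r s q h
    by_cases h1 : r = 0 ∨ p < r
    · rw [ha r h1, zero_mul, zero_mul]
    · by_cases h2 : s = 0 ∨ p < s
      · rw [hb s h2, mul_zero, zero_mul]
      · rw [he q (by omega), mul_zero]
  split_ifs with c1 c2 c3
  · rw [conv2_s15 a d i, conv2_s15 c e i, conv3 a b e i]
    · ring
    · intro r hr s hs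
      simp only [Finset.mem_Icc] at hr hs
      omega
    · intro r s hrs hn
      simp only [Finset.mem_Icc] at hn
      exact z3 _ _ _ (by omega)
    · intro r hr
      simp only [Finset.mem_Icc] at hr
      omega
    · intro r hr hn
      simp only [Finset.mem_Icc] at hn
      exact z2 c e hc he _ _ (by omega)
    · intro r hr
      simp only [Finset.mem_Icc] at hr
      omega
    · intro r hr hn
      simp only [Finset.mem_Icc] at hn
      exact z2 a d ha hd _ _ (by omega)
  · subst c2
    rw [conv2_s15 a d (p + 1), conv2_s15 c e (p + 1), conv3 a b e (p + 1), hf (p + 1) (by omega)]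
    · ring
    · intro r hr s hs
      simp only [Finset.mem_Icc] at hr hs
      omega
    · intro r s hrs hn
      simp only [Finset.mem_Icc] at hn
      exact z3 _ _ _ (by omega)
    · intro r hr
      simp only [Finset.mem_Icc] at hr
      omega
    · intro r hr hn
      simp only [Finset.mem_Icc] at hn
      exact z2 c e hc he _ _ (by omega)
    · intro r hr
      simp only [Finset.mem_Icc] at hr
      omega
    · intro r hr hn
      simp only [Finset.mem_Icc] at hn
      exact z2 a d ha hd _ _ (by omega)
  · have key : ∑ r ∈ Finset.Icc 1 (i - p - 1), ∑ s ∈ Finset.Icc (i - p - r) p,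
          a r * b s * e (i - r - s) + ∑ r ∈ Finset.Icc (i - p) p, ∑ s ∈ Finset.Icc 1 (i - r - 1),
          a r * b s * e (i - r - s) = coeff i (mk a * mk b * mk e) := by
      rw [← conv3 a b e i (Finset.Icc 1 p) (fun r => if r < i - p then Finset.Icc (i - p - r) p
        else Finset.Icc 1 (i - r - 1))]
      · have hu : Finset.Icc 1 p = Finset.Icc 1 (i - p - 1) ∪ Finset.Icc (i - p) p := by
          ext r
          simp only [Finset.mem_Icc, Finset.mem_union]
          omega
        rw [hu, Finset.sum_union]
        · congr 1
          · refine Finset.sum_congr rfl fun r hr => ?_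
            simp only [Finset.mem_Icc] at hr
            rw [if_pos (by omega)]
          · refine Finset.sum_congr rfl fun r hr => ?_
            simp only [Finset.mem_Icc] at hr
            rw [if_neg (by omega)]
        · rw [Finset.disjoint_left]
          intro r hr hr'
          simp only [Finset.mem_Icc] at hr hr'
          omega
      · intro r hr s hs
        simp only [Finset.mem_Icc] at hr hs
        split_ifs at hs <;> simp only [Finset.mem_Icc] at hs <;> omega
      · intro r s hrs hn
        apply z3
        split_ifs at hn <;> simp only [Finset.mem_Icc] at hn <;> omega
    rw [conv2_s15 a d i, conv2_s15 c e i, add_assoc, key, hf i (by omega)]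
    · ring
    · intro r hr
      simp only [Finset.mem_Icc] at hr
      omega
    · intro r hr hn
      simp only [Finset.mem_Icc] at hn
      exact z2 c e hc he _ _ (by omega)
    · intro r hr
      simp only [Finset.mem_Icc] at hr
      omega
    · intro r hr hn
      simp only [Finset.mem_Icc] at hn
      exact z2 a d ha hd _ _ (by omega)

/-- Truncated reversal of a power series. -/
def revT {k : Type*} [Field k] (p : ℕ) (φ : k⟦X⟧) : ℕ → k :=
  fun t => if 1 ≤ t ∧ t ≤ p then coeff (p - t) φ else 0

lemma revT_zero {k : Type*} [Field k] (p : ℕ) (φ : k⟦X⟧) (t : ℕ) (h : t = 0 ∨ p < t) :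
    revT p φ t = 0 := by
  rw [revT, if_neg (by omega)]

lemma revT_congr {k : Type*} [Field k] (p : ℕ) (φ ψ : k⟦X⟧) (h : X ^ p ∣ φ - ψ) :
    revT p φ = revT p ψ := by
  ext t
  unfold revT
  split_ifs with ht
  · have := X_pow_dvd_iff.1 h (p - t) (by omega)
    rw [map_sub] at this
    exact sub_eq_zero.1 this
  · rfl

lemma revT_mk {k : Type*} [Field k] (p : ℕ) (f : ℕ → k) (hf : ∀ t, (t = 0 ∨ p < t) → f t = 0) :
    revT p (mk fun l => f (p - l)) = f := by
  ext t
  unfold revT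
  split_ifs with ht
  · rw [coeff_mk]; congr 1; omega
  · exact (hf t (by omega)).symm

lemma revT_mul {k : Type*} [Field k] (p : ℕ) (φ ψ : k⟦X⟧) (i : ℕ) (hi : p < i) (hi2 : i ≤ 2 * p) :
    coeff i (mk (revT p φ) * mk (revT p ψ)) = coeff (2 * p - i) (φ * ψ) := by
  rw [coeff_mul, coeff_mul]
  symm
  refine Finset.sum_bij_ne_zero (fun q _ _ => (p - q.1, p - q.2)) ?_ ?_ ?_ ?_
  · rintro ⟨l, l'⟩ h _
    simp only [Finset.HasAntidiagonal.mem_antidiagonal] at h ⊢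
    omega
  · rintro ⟨l, l'⟩ h _ ⟨r, r'⟩ h' _ heq
    simp only [Finset.HasAntidiagonal.mem_antidiagonal, Prod.mk.injEq] at h h' heq ⊢
    omega
  · rintro ⟨r, r'⟩ h hne
    simp only [Finset.HasAntidiagonal.mem_antidiagonal, coeff_mk] at h hne
    have h1 : 1 ≤ r ∧ r ≤ p := by
      by_contra hcon
      exact hne (by rw [revT_zero p φ r (by omega), zero_mul])
    have h2 : 1 ≤ r' ∧ r' ≤ p := by
      by_contra hcon
      exact hne (by rw [revT_zero p ψ r' (by omega), mul_zero])
    refine ⟨(p - r, p - r'), ?_, ?_, ?_⟩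
    · simp only [Finset.HasAntidiagonal.mem_antidiagonal]; omega
    · simpa only [revT, if_pos h1, if_pos h2] using hne
    · simp only [Prod.mk.injEq]; omega
  · rintro ⟨l, l'⟩ h _
    simp only [Finset.HasAntidiagonal.mem_antidiagonal] at h
    simp only [coeff_mk, revT]
    rw [if_pos (by omega), if_pos (by omega)]
    congr 3 <;> omega

/-- The point with prescribed coordinates. -/
def mkpt {k : Type*} [Field k] (p : ℕ) (a b c d e f : ℕ → k) : Fin 3 × Fin 3 × Fin p → k :=
  fun q => (!![0, 0, a ((q.2.2 : ℕ) + 1); b ((q.2.2 : ℕ) + 1), 0, c ((q.2.2 : ℕ) + 1);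
    d ((q.2.2 : ℕ) + 1), e ((q.2.2 : ℕ) + 1), f ((q.2.2 : ℕ) + 1)] : Matrix (Fin 3) (Fin 3) k) q.1 q.2.1

lemma xvn_mkpt {k : Type*} [Field k] (p : ℕ) (a b c d e f : ℕ → k) (t : ℕ) (ht : 1 ≤ t)
    (ht2 : t ≤ p) :
    xvn k 3 p (mkpt p a b c d e f) 1 1 t = 0 ∧ xvn k 3 p (mkpt p a b c d e f) 1 2 t = 0 ∧
    xvn k 3 p (mkpt p a b c d e f) 2 2 t = 0 ∧ xvn k 3 p (mkpt p a b c d e f) 1 3 t = a t ∧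
    xvn k 3 p (mkpt p a b c d e f) 2 1 t = b t ∧ xvn k 3 p (mkpt p a b c d e f) 2 3 t = c t ∧
    xvn k 3 p (mkpt p a b c d e f) 3 1 t = d t ∧ xvn k 3 p (mkpt p a b c d e f) 3 2 t = e t ∧
    xvn k 3 p (mkpt p a b c d e f) 3 3 t = f t := by
  obtain ⟨t, rfl⟩ : ∃ t', t = t' + 1 := ⟨t - 1, by omega⟩
  unfold xvn
  refine ⟨?_, ?_, ?_, ?_, ?_, ?_, ?_, ?_, ?_⟩ <;> rw [dif_pos (by omega)] <;> rfl

lemma mkpt_surj {k : Type*} [Field k] (p : ℕ) (x : Fin 3 × Fin 3 × Fin p → k)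
    (hW : WZero k 3 p x) : x = mkpt p (xvn k 3 p x 1 3) (xvn k 3 p x 2 1) (xvn k 3 p x 2 3)
      (xvn k 3 p x 3 1) (xvn k 3 p x 3 2) (xvn k 3 p x 3 3) := by
  ext ⟨r, s, t⟩
  have h := hW (t + 1) (by omega) (by omega)
  simp only [xvn] at h
  rw [dif_pos (by omega), dif_pos (by omega), dif_pos (by omega)] at h
  fin_cases r <;> fin_cases s
  · exact h.1
  · exact h.2.1
  · change _ = xvn k 3 p x 1 3 (t + 1)
    rw [xvn, dif_pos (by omega)]; rfl
  · change _ = xvn k 3 p x 2 1 (t + 1)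
    rw [xvn, dif_pos (by omega)]; rfl
  · exact h.2.2
  · change _ = xvn k 3 p x 2 3 (t + 1)
    rw [xvn, dif_pos (by omega)]; rfl
  · change _ = xvn k 3 p x 3 1 (t + 1)
    rw [xvn, dif_pos (by omega)]; rfl
  · change _ = xvn k 3 p x 3 2 (t + 1)
    rw [xvn, dif_pos (by omega)]; rfl
  · change _ = xvn k 3 p x 3 3 (t + 1)
    rw [xvn, dif_pos (by omega)]; rfl

lemma mkpt_congr {k : Type*} [Field k] (p : ℕ) {a b c d e f a' b' c' d' e' f' : ℕ → k}
    (h : ∀ t, 1 ≤ t → t ≤ p → a t = a' t ∧ b t = b' t ∧ c t = c' t ∧ d t = d' t ∧ e t = e' t ∧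
      f t = f' t) : mkpt p a b c d e f = mkpt p a' b' c' d' e' f' := by
  ext ⟨r, s, t⟩
  obtain ⟨h1, h2, h3, h4, h5, h6⟩ := h (t + 1) (by omega) (by omega)
  simp only [mkpt, h1, h2, h3, h4, h5, h6]

/-- The point attached to power series data. -/
def ptOf {k : Type*} [Field k] (p : ℕ) (α γ δ ε : k⟦X⟧) (b : ℕ → k) : Fin 3 × Fin 3 × Fin p → k :=
  mkpt p (revT p α) b (fun t => coeff t (mk (revT p α) * mk b) - revT p γ t) (revT p δ) (revT p ε)
    (fun t => coeff t (mk (revT p α) * mk (revT p δ) - mk (revT p γ) * mk (revT p ε)))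

lemma ptOf_mem {k : Type*} [Field k] {p : ℕ} (hp : 2 < p) (m : ℕ) (hm : m ≤ p) (α γ δ ε : k⟦X⟧)
    (b : ℕ → k) (hα : X ^ m ∣ α) (hb : ∀ t, (t = 0 ∨ m < t) → b t = 0)
    (hdet : X ^ p ∣ γ * ε - α * δ) : ptOf p α γ δ ε b ∈ W1 k 3 p := by
  have H : ∀ t, 1 ≤ t → t ≤ p → _ := fun t h1 h2 => xvn_mkpt p (revT p α) b
    (fun t => coeff t (mk (revT p α) * mk b) - revT p γ t) (revT p δ) (revT p ε)
    (fun t => coeff t (mk (revT p α) * mk (revT p δ) - mk (revT p γ) * mk (revT p ε))) t h1 h2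
  have hαt : ∀ t, p + 1 - m ≤ t → revT p α t = 0 := by
    intro t ht
    unfold revT
    split_ifs with h
    · exact X_pow_dvd_iff.1 hα _ (by omega)
    · rfl
  have hAB : ∀ t, (t = 0 ∨ p < t) → coeff t (mk (revT p α) * mk b) = 0 := by
    intro t ht
    rw [coeff_mul]
    refine Finset.sum_eq_zero ?_
    rintro ⟨r, s⟩ hrs
    simp only [Finset.HasAntidiagonal.mem_antidiagonal] at hrs
    simp only [coeff_mk]
    by_cases h1 : p + 1 - m ≤ r
    · rw [hαt r h1, zero_mul]
    · rw [hb s (by omega), mul_zero]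
  change mkpt _ _ _ _ _ _ _ ∈ _
  generalize hx : mkpt p (revT p α) b (fun t => coeff t (mk (revT p α) * mk b) - revT p γ t)
    (revT p δ) (revT p ε)
    (fun t => coeff t (mk (revT p α) * mk (revT p δ) - mk (revT p γ) * mk (revT p ε))) = x at *
  have ha : xvn k 3 p x 1 3 = revT p α := by
    ext t
    by_cases ht : 1 ≤ t ∧ t ≤ p
    · exact (H t ht.1 ht.2).2.2.2.1
    · rw [xvn_zero _ _ _ _ (by omega), revT_zero _ _ _ (by omega)]
  have hb' : xvn k 3 p x 2 1 = b := by
    ext t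
    by_cases ht : 1 ≤ t ∧ t ≤ p
    · exact (H t ht.1 ht.2).2.2.2.2.1
    · rw [xvn_zero _ _ _ _ (by omega), hb _ (by omega)]
  have hc : mk (xvn k 3 p x 2 3) = mk (revT p α) * mk b - mk (revT p γ) := by
    ext t
    rw [coeff_mk, map_sub, coeff_mk]
    by_cases ht : 1 ≤ t ∧ t ≤ p
    · exact (H t ht.1 ht.2).2.2.2.2.2.1
    · rw [xvn_zero _ _ _ _ (by omega), revT_zero _ _ _ (by omega), hAB _ (by omega), sub_zero]
  have hd : xvn k 3 p x 3 1 = revT p δ := by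
    ext t
    by_cases ht : 1 ≤ t ∧ t ≤ p
    · exact (H t ht.1 ht.2).2.2.2.2.2.2.1
    · rw [xvn_zero _ _ _ _ (by omega), revT_zero _ _ _ (by omega)]
  have he : xvn k 3 p x 3 2 = revT p ε := by
    ext t
    by_cases ht : 1 ≤ t ∧ t ≤ p
    · exact (H t ht.1 ht.2).2.2.2.2.2.2.2.1
    · rw [xvn_zero _ _ _ _ (by omega), revT_zero _ _ _ (by omega)]
  have hW : WZero k 3 p x := fun t h1 h2 =>
    ⟨(H t h1 h2).1, (H t h1 h2).2.1, (H t h1 h2).2.2.1⟩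
  refine Set.mem_biUnion (x := p + 1 - m) ⟨by omega, by omega⟩ ⟨hW, ?_, ?_, ?_, ?_⟩
  · intro j h1 h2
    rw [P3v_eq hp x hW j h1 h2, ha, hb', hc, hd, he]
    have hr : mk (revT p α) * mk b * mk (revT p ε) - mk (revT p α) * mk (revT p δ) -
        (mk (revT p α) * mk b - mk (revT p γ)) * mk (revT p ε) =
        mk (revT p γ) * mk (revT p ε) - mk (revT p α) * mk (revT p δ) := by ring
    rw [hr]
    by_cases hj : j ≤ p
    · rw [(H j h1 hj).2.2.2.2.2.2.2.2, ← map_add]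
      simp
    · rw [xvn_zero _ _ _ _ (by omega), map_sub, revT_mul _ _ _ _ (by omega) h2,
        revT_mul _ _ _ _ (by omega) h2, ← map_sub, X_pow_dvd_iff.1 hdet _ (by omega), zero_add]
  · intro t h1 h2
    rw [ha]; exact hαt t h1
  · intro t h1 h2
    rw [hb']; exact hb t (by omega)
  · intro m' j h1 h2
    omega

lemma exists_ptOf {k : Type*} [Field k] {p : ℕ} (hp : 2 < p) (x : Fin 3 × Fin 3 × Fin p → k)
    (hx : x ∈ W1 k 3 p) : ∃ (m : ℕ) (α γ δ ε : k⟦X⟧) (b : ℕ → k), m ≤ p ∧ X ^ m ∣ α ∧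
      (m < p → coeff m α ≠ 0) ∧ (∀ t, (t = 0 ∨ m < t) → b t = 0) ∧ X ^ p ∣ γ * ε - α * δ ∧
      x = ptOf p α γ δ ε b := by
  obtain ⟨s, ⟨hs1, hs2⟩, hW, hP, h13, h21, -⟩ := Set.mem_iUnion₂.1 hx
  have ha0 := xvn_zero x 1 3
  have hb0 := xvn_zero x 2 1
  have hc0 := xvn_zero x 2 3
  have hd0 := xvn_zero x 3 1
  have he0 := xvn_zero x 3 2
  have hx := mkpt_surj p x hW
  have hP' := fun i h1 h2 => (P3v_eq hp x hW i h1 h2).symm.trans (hP i h1 h2)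
  have hf0 := xvn_zero x 3 3
  generalize xvn k 3 p x 1 3 = a at *
  generalize xvn k 3 p x 2 1 = b at *
  generalize xvn k 3 p x 2 3 = c at *
  generalize xvn k 3 p x 3 1 = d at *
  generalize xvn k 3 p x 3 2 = e at *
  generalize xvn k 3 p x 3 3 = f at *
  have ha1 : ∀ t, s ≤ t → a t = 0 := fun t ht => by
    by_cases h : t ≤ p
    · exact h13 t ht h
    · exact ha0 t (by omega)
  have hb1 : ∀ t, p + 2 - s ≤ t → b t = 0 := fun t ht => by
    by_cases h : t ≤ p
    · exact h21 t ht h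
    · exact hb0 t (by omega)
  -- the order of α
  obtain ⟨m, hm, hms, hm1, hm2⟩ : ∃ m ≤ p, p + 1 - s ≤ m ∧ (∀ l < m, a (p - l) = 0) ∧
      (m < p → a (p - m) ≠ 0) := by
    by_cases h : ∃ l, l < p ∧ a (p - l) ≠ 0
    · refine ⟨Nat.find h, (Nat.find_spec h).1.le, ?_, ?_, fun _ => (Nat.find_spec h).2⟩
      · by_contra hlt
        exact (Nat.find_spec h).2 (ha1 _ (by omega))
      · intro l hl
        have := Nat.find_min h hl
        have h3 := (Nat.find_spec h).1
        by_contra hne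
        exact this ⟨by omega, hne⟩
    · push Not at h
      exact ⟨p, le_rfl, by omega, h, fun h => absurd h (lt_irrefl _)⟩
  have hAB : ∀ t, (t = 0 ∨ p < t) → coeff t (mk a * mk b) = 0 := by
    intro t ht
    rw [coeff_mul]
    refine Finset.sum_eq_zero ?_
    rintro ⟨r, q⟩ hrs
    simp only [Finset.HasAntidiagonal.mem_antidiagonal] at hrs
    simp only [coeff_mk]
    by_cases h1 : s ≤ r
    · rw [ha1 r h1, zero_mul]
    · by_cases h2 : q = 0
      · rw [hb0 q (by omega), mul_zero]
      · rw [hb1 q (by omega), mul_zero]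
  have hC : ∀ t, (t = 0 ∨ p < t) → coeff t (mk a * mk b) - c t = 0 := fun t ht => by
    rw [hAB t ht, hc0 t ht, sub_zero]
  have hC' : mk a * mk b - mk c = mk (fun t => coeff t (mk a * mk b) - c t) := by
    ext t; simp only [map_sub, coeff_mk]
  have hr : mk a * mk b * mk e - mk a * mk d - mk c * mk e =
      mk (fun t => coeff t (mk a * mk b) - c t) * mk e - mk a * mk d := by
    rw [← hC']; ring
  rw [hr] at hP'
  have ra := revT_mk p a ha0
  have rd := revT_mk p d hd0
  have re := revT_mk p e he0
  have rg := revT_mk p _ hC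
  refine ⟨m, mk fun l => a (p - l), mk fun l => coeff (p - l) (mk a * mk b) - c (p - l),
    mk fun l => d (p - l), mk fun l => e (p - l), b, hm, ?_, ?_, ?_, ?_, ?_⟩
  · rw [X_pow_dvd_iff]
    intro l hl
    rw [coeff_mk]; exact hm1 l hl
  · intro h
    rw [coeff_mk]; exact hm2 h
  · rintro t (h | h)
    · exact hb0 t (by omega)
    · exact hb1 t (by omega)
  · rw [X_pow_dvd_iff]
    intro l hl
    have h := hP' (2 * p - l) (by omega) (by omega)
    rw [hf0 _ (by omega), zero_add, map_sub] at h
    have e1 := revT_mul p (mk fun l => coeff (p - l) (mk a * mk b) - c (p - l))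
      (mk fun l => e (p - l)) (2 * p - l) (by omega) (by omega)
    have e2 := revT_mul p (mk fun l => a (p - l))
      (mk fun l => d (p - l)) (2 * p - l) (by omega) (by omega)
    rw [rg, re] at e1
    rw [ra, rd] at e2
    rw [e1, e2, show 2 * p - (2 * p - l) = l by omega] at h
    rw [map_sub]; exact h
  · rw [ptOf, ra, rd, re, rg]
    refine hx.trans (mkpt_congr p ?_)
    intro t h1 h2
    have := hP' t h1 (by omega)
    refine ⟨rfl, rfl, by ring, rfl, rfl, ?_⟩
    rw [map_sub] at this ⊢
    linear_combination this

end Specific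

section Param

open PowerSeries

/-- Extension by zero. -/
def extZ {k : Type*} [Field k] {n : ℕ} (w : Fin n → k) : ℕ → k :=
  fun t => if h : t < n then w ⟨t, h⟩ else 0

/-- A segment of a sequence as a truncated power series. -/
def segS {k : Type*} [Field k] (W : ℕ → k) (o len : ℕ) : k⟦X⟧ :=
  mk fun t => if t < len then W (o + t) else 0

/-- The parametrizations. -/
def phi {k : Type*} [Field k] (p m i : ℕ) (w : Fin (3 * p) → k) : Fin 3 × Fin 3 × Fin p → k :=
  ptOf p (X ^ m * (1 + segS (extZ w) (2 * p + m) (p - m)))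
    (X ^ i * ((1 + segS (extZ w) (2 * p + m) (p - m)) * segS (extZ w) (p + i) (p - i)))
    (segS (extZ w) (p + i) (p - i) * segS (extZ w) m (p - m + i) + X ^ (p - m) * segS (extZ w) 0 m)
    (X ^ (m - i) * segS (extZ w) m (p - m + i))
    (fun t => if 1 ≤ t ∧ t ≤ m then extZ w (2 * p + (t - 1)) else 0)

lemma phi_mem {k : Type*} [Field k] {p : ℕ} (hp : 2 < p) (m i : ℕ) (hm : m ≤ p) (hi : i ≤ m)
    (w : Fin (3 * p) → k) : phi p m i w ∈ W1 k 3 p := by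
  refine ptOf_mem hp m hm _ _ _ _ _ (Dvd.intro _ rfl) ?_ ?_
  · intro t ht
    rw [if_neg (by omega)]
  · generalize segS (extZ w) (2 * p + m) (p - m) = Y
    generalize segS (extZ w) (p + i) (p - i) = G
    generalize segS (extZ w) m (p - m + i) = E
    generalize segS (extZ w) 0 m = D
    refine ⟨- ((1 + Y) * D), ?_⟩
    have h1 : (X : k⟦X⟧) ^ i * X ^ (m - i) = X ^ m := by rw [← pow_add]; congr 1; omega
    have h2 : (X : k⟦X⟧) ^ m * X ^ (p - m) = X ^ p := by rw [← pow_add]; congr 1; omega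
    linear_combination ((1 + Y) * G * E) * h1 - ((1 + Y) * D) * h2

/-- Polynomial functions. -/
def IsPolyF {k : Type*} [Field k] {n : ℕ} (f : (Fin n → k) → k) : Prop :=
  ∃ P : MvPolynomial (Fin n) k, ∀ w, f w = MvPolynomial.eval w P

lemma IsPolyF.const {k : Type*} [Field k] {n : ℕ} (c : k) : IsPolyF (fun _ : Fin n → k => c) :=
  ⟨MvPolynomial.C c, by simp⟩

lemma IsPolyF.add {k : Type*} [Field k] {n : ℕ} {f g : (Fin n → k) → k} (hf : IsPolyF f)
    (hg : IsPolyF g) : IsPolyF (fun w => f w + g w) := by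
  obtain ⟨P, hP⟩ := hf
  obtain ⟨Q, hQ⟩ := hg
  exact ⟨P + Q, by simp [hP, hQ]⟩

lemma IsPolyF.sub {k : Type*} [Field k] {n : ℕ} {f g : (Fin n → k) → k} (hf : IsPolyF f)
    (hg : IsPolyF g) : IsPolyF (fun w => f w - g w) := by
  obtain ⟨P, hP⟩ := hf
  obtain ⟨Q, hQ⟩ := hg
  exact ⟨P - Q, by simp [hP, hQ]⟩

lemma IsPolyF.mul {k : Type*} [Field k] {n : ℕ} {f g : (Fin n → k) → k} (hf : IsPolyF f)
    (hg : IsPolyF g) : IsPolyF (fun w => f w * g w) := by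
  obtain ⟨P, hP⟩ := hf
  obtain ⟨Q, hQ⟩ := hg
  exact ⟨P * Q, by simp [hP, hQ]⟩

lemma IsPolyF.sum {k : Type*} [Field k] {n : ℕ} {ι : Type*} (s : Finset ι)
    {f : ι → (Fin n → k) → k} (hf : ∀ i ∈ s, IsPolyF (f i)) :
    IsPolyF (fun w => ∑ i ∈ s, f i w) := by
  induction s using Finset.induction_on with
  | empty => simpa using IsPolyF.const 0
  | insert a s ha ih =>
    simp only [Finset.sum_insert ha]
    exact (hf a (by simp)).add (ih fun i hi => hf i (by simp [hi]))

lemma IsPolyF.extZ {k : Type*} [Field k] {n : ℕ} (t : ℕ) :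
    IsPolyF (fun w : Fin n → k => extZ w t) := by
  unfold _root_.extZ
  split_ifs with h
  · exact ⟨MvPolynomial.X ⟨t, h⟩, by simp⟩
  · exact IsPolyF.const 0

/-- Power series with polynomial coefficients. -/
def IsPolyS {k : Type*} [Field k] {n : ℕ} (F : (Fin n → k) → k⟦X⟧) : Prop :=
  ∀ t, IsPolyF (fun w => coeff t (F w))

lemma IsPolyS.const {k : Type*} [Field k] {n : ℕ} (c : k⟦X⟧) : IsPolyS (fun _ : Fin n → k => c) :=
  fun _ => IsPolyF.const _

lemma IsPolyS.add {k : Type*} [Field k] {n : ℕ} {f g : (Fin n → k) → k⟦X⟧} (hf : IsPolyS f)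
    (hg : IsPolyS g) : IsPolyS (fun w => f w + g w) := fun t => by
  simpa only [map_add] using (hf t).add (hg t)

lemma IsPolyS.sub {k : Type*} [Field k] {n : ℕ} {f g : (Fin n → k) → k⟦X⟧} (hf : IsPolyS f)
    (hg : IsPolyS g) : IsPolyS (fun w => f w - g w) := fun t => by
  simpa only [map_sub] using (hf t).sub (hg t)

lemma IsPolyS.mul {k : Type*} [Field k] {n : ℕ} {f g : (Fin n → k) → k⟦X⟧} (hf : IsPolyS f)
    (hg : IsPolyS g) : IsPolyS (fun w => f w * g w) := fun t => by
  simp only [coeff_mul]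
  exact IsPolyF.sum _ fun q _ => (hf q.1).mul (hg q.2)

lemma IsPolyS.segS {k : Type*} [Field k] {n : ℕ} (o len : ℕ) :
    IsPolyS (fun w : Fin n → k => segS (extZ w) o len) := fun t => by
  simp only [_root_.segS, coeff_mk]
  split_ifs
  · exact IsPolyF.extZ _
  · exact IsPolyF.const 0

lemma IsPolyS.revT {k : Type*} [Field k] {n : ℕ} (p : ℕ) {f : (Fin n → k) → k⟦X⟧}
    (hf : IsPolyS f) (t : ℕ) : IsPolyF (fun w => revT p (f w) t) := by
  unfold _root_.revT
  split_ifs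
  · exact hf _
  · exact IsPolyF.const 0

lemma IsPolyS.mk {k : Type*} [Field k] {n : ℕ} {f : (Fin n → k) → ℕ → k}
    (hf : ∀ t, IsPolyF (fun w => f w t)) : IsPolyS (fun w => PowerSeries.mk (f w)) := fun t => by
  simpa only [coeff_mk] using hf t

lemma ptOf_poly {k : Type*} [Field k] {n : ℕ} (p : ℕ) {α γ δ ε : (Fin n → k) → k⟦X⟧}
    {b : (Fin n → k) → ℕ → k} (hα : IsPolyS α) (hγ : IsPolyS γ) (hδ : IsPolyS δ) (hε : IsPolyS ε)
    (hb : ∀ t, IsPolyF (fun w => b w t)) (q : Fin 3 × Fin 3 × Fin p) :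
    IsPolyF (fun w => ptOf p (α w) (γ w) (δ w) (ε w) (b w) q) := by
  have hA := IsPolyS.mk (hα.revT p)
  have hB := IsPolyS.mk hb
  have hG := IsPolyS.mk (hγ.revT p)
  have hD := IsPolyS.mk (hδ.revT p)
  have hE := IsPolyS.mk (hε.revT p)
  obtain ⟨r, s, t⟩ := q
  fin_cases r <;> fin_cases s
  · exact IsPolyF.const 0
  · exact IsPolyF.const 0
  · exact hα.revT p _
  · exact hb _
  · exact IsPolyF.const 0
  · exact ((hA.mul hB) _).sub (hγ.revT p _)
  · exact hδ.revT p _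
  · exact hε.revT p _
  · exact ((hA.mul hD).sub (hG.mul hE)) _

lemma phi_poly {k : Type*} [Field k] (p m i : ℕ) (q : Fin 3 × Fin 3 × Fin p) :
    IsPolyF (fun w : Fin (3 * p) → k => phi p m i w q) := by
  unfold phi
  refine ptOf_poly p (α := fun w => X ^ m * (1 + segS (extZ w) (2 * p + m) (p - m)))
    (γ := fun w => X ^ i * ((1 + segS (extZ w) (2 * p + m) (p - m)) * segS (extZ w) (p + i) (p - i)))
    (δ := fun w => segS (extZ w) (p + i) (p - i) * segS (extZ w) m (p - m + i) + X ^ (p - m) * segS (extZ w) 0 m)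
    (ε := fun w => X ^ (m - i) * segS (extZ w) m (p - m + i))
    (b := fun w t => if 1 ≤ t ∧ t ≤ m then extZ w (2 * p + (t - 1)) else 0) ?_ ?_ ?_ ?_ ?_ q
  · exact (IsPolyS.const _).mul ((IsPolyS.const _).add (IsPolyS.segS _ _))
  · exact (IsPolyS.const _).mul (((IsPolyS.const _).add (IsPolyS.segS _ _)).mul (IsPolyS.segS _ _))
  · exact ((IsPolyS.segS _ _).mul (IsPolyS.segS _ _)).add ((IsPolyS.const _).mul (IsPolyS.segS _ _))
  · exact (IsPolyS.const _).mul (IsPolyS.segS _ _)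
  · intro t
    split_ifs
    · exact IsPolyF.extZ _
    · exact IsPolyF.const 0

lemma phi_chain {k : Type*} [Field k] (p m i : ℕ) (hm : m ≤ p) (hi : i ≤ m) (j : Fin (3 * p)) :
    ∃ s : Fin 3 × Fin 3 × Fin p, ∃ c d : k, d ≠ 0 ∧
      ∀ w : Fin (3 * p) → k, (∀ l, j < l → w l = 0) → phi p m i w s = c + d * w j := by
  have hj := j.2
  have hext : ∀ w : Fin (3 * p) → k, (∀ l, j < l → w l = 0) → ∀ t, (j : ℕ) < t → extZ w t = 0 := by
    intro w hw t ht
    unfold extZ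
    split_ifs with h
    · exact hw ⟨t, h⟩ ht
    · rfl
  have hextj : ∀ w : Fin (3 * p) → k, ∀ t, t = (j : ℕ) → extZ w t = w j := by
    rintro w t rfl
    unfold extZ
    rw [dif_pos hj]
  have hseg : ∀ w : Fin (3 * p) → k, (∀ l, j < l → w l = 0) → ∀ o len, (j : ℕ) < o →
      segS (extZ w) o len = 0 := by
    intro w hw o len ho
    ext t
    simp only [segS, coeff_mk, map_zero]
    split_ifs
    · exact hext w hw _ (by omega)
    · rfl
  by_cases c1 : (j : ℕ) < m
  · refine ⟨(2, 0, ⟨m - j - 1, by omega⟩), 0, 1, one_ne_zero, fun w hw => ?_⟩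
    change revT p _ (m - j - 1 + 1) = _
    rw [hseg w hw (p + i) _ (by omega), revT, if_pos (by omega), zero_mul, zero_add,
      coeff_X_pow_mul', if_pos (by omega), segS, coeff_mk, if_pos (by omega),
      hextj w _ (by omega), zero_add, one_mul]
  by_cases c2 : (j : ℕ) < p + i
  · refine ⟨(2, 1, ⟨p - (j - i) - 1, by omega⟩), 0, 1, one_ne_zero, fun w hw => ?_⟩
    change revT p _ (p - (j - i) - 1 + 1) = _
    rw [revT, if_pos (by omega),
      coeff_X_pow_mul', if_pos (by omega), segS, coeff_mk, if_pos (by omega),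
      hextj w _ (by omega), zero_add, one_mul]
  by_cases c3 : (j : ℕ) < 2 * p
  · refine ⟨(1, 2, ⟨2 * p - j - 1, by omega⟩), 0, -1, neg_ne_zero.2 one_ne_zero, fun w hw => ?_⟩
    change coeff (2 * p - j - 1 + 1) (mk _ * mk _ : k⟦X⟧) - revT p _ (2 * p - j - 1 + 1) = _
    have hb : (mk fun t => if 1 ≤ t ∧ t ≤ m then extZ w (2 * p + (t - 1)) else 0) = 0 := by
      ext t
      simp only [coeff_mk, map_zero]
      split_ifs
      · exact hext w hw _ (by omega)
      · rfl
    rw [hb, hseg w hw (2 * p + m) _ (by omega), mul_zero, map_zero, add_zero, one_mul,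
      revT, if_pos (by omega),
      coeff_X_pow_mul', if_pos (by omega), segS, coeff_mk, if_pos (by omega),
      hextj w _ (by omega)]
    ring
  by_cases c4 : (j : ℕ) < 2 * p + m
  · refine ⟨(1, 0, ⟨j - 2 * p, by omega⟩), 0, 1, one_ne_zero, fun w hw => ?_⟩
    change (if 1 ≤ (j - 2 * p + 1) ∧ (j - 2 * p + 1) ≤ m then
      extZ w (2 * p + ((j - 2 * p + 1) - 1)) else 0) = _
    rw [if_pos (by omega), hextj w _ (by omega), zero_add, one_mul]
  · refine ⟨(0, 2, ⟨3 * p - j - 1, by omega⟩), coeff (j - 2 * p - m) (1 : k⟦X⟧), 1, one_ne_zero,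
      fun w hw => ?_⟩
    change revT p _ (3 * p - j - 1 + 1) = _
    rw [revT, if_pos (by omega), coeff_X_pow_mul', if_pos (by omega), map_add, segS, coeff_mk,
      if_pos (by omega), hextj w _ (by omega), one_mul]
    congr 3
    omega

lemma exists_split {k : Type*} [Field k] (m : ℕ) (γ ε : k⟦X⟧) (h : X ^ m ∣ γ * ε) :
    ∃ i ≤ m, X ^ i ∣ γ ∧ X ^ (m - i) ∣ ε := by
  by_cases hγ : X ^ m ∣ γ
  · exact ⟨m, le_rfl, hγ, by simp⟩
  · have h0 : ∃ i, ¬ X ^ (i + 1) ∣ γ := ⟨m, fun h => hγ ((pow_dvd_pow _ (by omega)).trans h)⟩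
    have hlt : Nat.find h0 < m := by
      by_contra hge
      refine hγ ?_
      by_cases hm : m = 0
      · subst hm; simp
      · have := Nat.find_min h0 (m := m - 1) (by omega)
        rw [not_not] at this
        rwa [show m - 1 + 1 = m by omega] at this
    have hdvd : X ^ Nat.find h0 ∣ γ := by
      by_cases hz : Nat.find h0 = 0
      · rw [hz]; simp
      · have := Nat.find_min h0 (m := Nat.find h0 - 1) (by omega)
        rw [not_not] at this
        rwa [show Nat.find h0 - 1 + 1 = Nat.find h0 by omega] at this
    have hspec := Nat.find_spec h0
    generalize Nat.find h0 = i at *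
    obtain ⟨γ', rfl⟩ := hdvd
    refine ⟨i, hlt.le, Dvd.intro _ rfl, ?_⟩
    have hX : (X : k⟦X⟧) ≠ 0 := X_ne_zero
    rw [pow_succ, mul_dvd_mul_iff_left (pow_ne_zero _ hX)] at hspec
    rw [show m = i + (m - i) by omega, pow_add, mul_assoc,
      mul_dvd_mul_iff_left (pow_ne_zero _ hX)] at h
    exact X_prime.pow_dvd_of_dvd_mul_left _ hspec h

lemma seg_sub_dvd {k : Type*} [Field k] (W : ℕ → k) (o len : ℕ) (F : k⟦X⟧)
    (h : ∀ t < len, W (o + t) = coeff t F) : X ^ len ∣ segS W o len - F := by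
  rw [X_pow_dvd_iff]
  intro t ht
  rw [map_sub, segS, coeff_mk, if_pos ht, h t ht, sub_self]

lemma exists_phi {k : Type*} [Field k] {p : ℕ} (m : ℕ) (hm : m ≤ p) (α γ δ ε : k⟦X⟧) (b : ℕ → k)
    (hα : X ^ m ∣ α) (hα' : m < p → coeff m α ≠ 0) (hb : ∀ t, (t = 0 ∨ m < t) → b t = 0)
    (hdet : X ^ p ∣ γ * ε - α * δ) :
    ∃ i ≤ m, ∃ w : Fin (3 * p) → k, phi p m i w = ptOf p α γ δ ε b := by
  have hX : (X : k⟦X⟧) ≠ 0 := X_ne_zero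
  -- normalise `α`
  obtain ⟨μ, hμ, hμα, hμt⟩ : ∃ μ : k⟦X⟧, constantCoeff μ ≠ 0 ∧ X ^ p ∣ X ^ m * μ - α ∧
      ∀ t, p - m ≤ t → coeff t (μ - 1) = 0 := by
    obtain ⟨μ, rfl⟩ := hα
    by_cases h : m < p
    · refine ⟨mk fun t => if t < p - m then coeff t μ else 0, ?_, ?_, ?_⟩
      · rw [← coeff_zero_eq_constantCoeff_apply, coeff_mk, if_pos (by omega)]
        have := hα' h
        have h2 := coeff_X_pow_mul μ m 0
        rw [zero_add] at h2
        rwa [h2] at this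
      · rw [← mul_sub, show p = m + (p - m) by omega, pow_add]
        refine mul_dvd_mul_left _ ?_
        rw [X_pow_dvd_iff]
        intro t ht
        rw [map_sub, coeff_mk, if_pos (by omega), sub_self]
      · intro t ht
        rw [map_sub, coeff_mk, if_neg (by omega), coeff_one, if_neg (by omega), sub_self]
    · obtain rfl : m = p := by omega
      exact ⟨1, by simp, ⟨1 - μ, by ring⟩, by simp⟩
  have hdet' : X ^ p ∣ γ * ε - X ^ m * μ * δ := by
    have : γ * ε - X ^ m * μ * δ = (γ * ε - α * δ) - (X ^ m * μ - α) * δ := by ring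
    rw [this]
    exact dvd_sub hdet (Dvd.dvd.mul_right hμα _)
  obtain ⟨i, hi, ⟨γ₁, rfl⟩, ⟨ε₁, rfl⟩⟩ : ∃ i ≤ m, X ^ i ∣ γ ∧ X ^ (m - i) ∣ ε := by
    refine exists_split m γ ε ?_
    have h1 : X ^ m ∣ γ * ε - X ^ m * μ * δ := (pow_dvd_pow _ hm).trans hdet'
    have h2 : X ^ m ∣ X ^ m * μ * δ := ⟨μ * δ, by ring⟩
    simpa using dvd_add h1 h2
  have hμi : μ * μ⁻¹ = 1 := PowerSeries.mul_inv_cancel μ hμ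
  have hpim : (X : k⟦X⟧) ^ i * X ^ (m - i) = X ^ m := by rw [← pow_add]; congr 1; omega
  have hppm : (X : k⟦X⟧) ^ m * X ^ (p - m) = X ^ p := by rw [← pow_add]; congr 1; omega
  have hppi : (X : k⟦X⟧) ^ i * X ^ (p - i) = X ^ p := by rw [← pow_add]; congr 1; omega
  have hpe : (X : k⟦X⟧) ^ (m - i) * X ^ (p - m + i) = X ^ p := by rw [← pow_add]; congr 1; omega
  have hδ : X ^ (p - m) ∣ γ₁ * μ⁻¹ * ε₁ - δ := by
    have h1 : X ^ m * X ^ (p - m) ∣ X ^ m * (γ₁ * ε₁ - μ * δ) := by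
      rw [hppm]
      convert hdet' using 1
      linear_combination -(γ₁ * ε₁) * hpim
    have h2 := (mul_dvd_mul_iff_left (pow_ne_zero _ hX)).1 h1
    have h3 : γ₁ * μ⁻¹ * ε₁ - δ = μ⁻¹ * (γ₁ * ε₁ - μ * δ) := by
      linear_combination δ * hμi
    rw [h3]
    exact Dvd.dvd.mul_left h2 _
  let G0 : k⟦X⟧ := mk fun t => if t < p - i then coeff t (γ₁ * μ⁻¹) else 0
  let E0 : k⟦X⟧ := mk fun t => if t < p - m + i then coeff t ε₁ else 0
  have hG0 : X ^ (p - i) ∣ G0 - γ₁ * μ⁻¹ := by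
    rw [X_pow_dvd_iff]
    intro t ht
    rw [map_sub, coeff_mk, if_pos ht, sub_self]
  have hE0 : X ^ (p - m + i) ∣ E0 - ε₁ := by
    rw [X_pow_dvd_iff]
    intro t ht
    rw [map_sub, coeff_mk, if_pos ht, sub_self]
  have hG1 : X ^ (p - m) ∣ G0 - γ₁ * μ⁻¹ := (pow_dvd_pow _ (by omega)).trans hG0
  have hE1 : X ^ (p - m) ∣ E0 - ε₁ := (pow_dvd_pow _ (by omega)).trans hE0
  obtain ⟨D1, hD1⟩ : X ^ (p - m) ∣ δ - G0 * E0 := by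
    have : δ - G0 * E0 = -(γ₁ * μ⁻¹ * ε₁ - δ) - (G0 - γ₁ * μ⁻¹) * E0 - γ₁ * μ⁻¹ * (E0 - ε₁) := by
      ring
    rw [this]
    exact dvd_sub (dvd_sub (dvd_neg.2 hδ) (Dvd.dvd.mul_right hG1 _)) (Dvd.dvd.mul_left hE1 _)
  let W : ℕ → k := fun t =>
    if t < m then coeff t D1
    else if t < p + i then coeff (t - m) ε₁
    else if t < 2 * p then coeff (t - (p + i)) (γ₁ * μ⁻¹)
    else if t < 2 * p + m then b (t - 2 * p + 1)
    else coeff (t - (2 * p + m)) (μ - 1)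
  let w : Fin (3 * p) → k := fun j => W j
  have hw : ∀ t, t < 3 * p → extZ w t = W t := by
    intro t ht
    unfold extZ
    rw [dif_pos ht]
  have sG : segS (extZ w) (p + i) (p - i) = G0 := by
    ext t
    simp only [segS, G0, coeff_mk]
    split_ifs with h
    · rw [hw _ (by omega)]
      simp only [W]
      rw [if_neg (by omega), if_neg (by omega), if_pos (by omega)]
      congr 2; omega
    · rfl
  have sE : segS (extZ w) m (p - m + i) = E0 := by
    ext t
    simp only [segS, E0, coeff_mk]
    split_ifs with h
    · rw [hw _ (by omega)]
      simp only [W]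
      rw [if_neg (by omega), if_pos (by omega)]
      congr 2; omega
    · rfl
  have sD : X ^ m ∣ segS (extZ w) 0 m - D1 := by
    refine seg_sub_dvd _ _ _ _ fun t ht => ?_
    rw [hw _ (by omega)]
    simp only [W]
    rw [if_pos (by omega), zero_add]
  have sY : 1 + segS (extZ w) (2 * p + m) (p - m) = μ := by
    have : segS (extZ w) (2 * p + m) (p - m) = μ - 1 := by
      ext t
      simp only [segS, coeff_mk]
      split_ifs with h
      · rw [hw _ (by omega)]
        simp only [W]
        rw [if_neg (by omega), if_neg (by omega), if_neg (by omega), if_neg (by omega)]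
        congr 2; omega
      · exact (hμt t (by omega)).symm
    rw [this]
    ring
  have sB : (fun t => if 1 ≤ t ∧ t ≤ m then extZ w (2 * p + (t - 1)) else 0) = b := by
    ext t
    split_ifs with h
    · rw [hw _ (by omega)]
      simp only [W]
      rw [if_neg (by omega), if_neg (by omega), if_neg (by omega), if_pos (by omega)]
      congr 1; omega
    · exact (hb t (by omega)).symm
  refine ⟨i, hi, w, ?_⟩
  rw [phi, sB, sG, sE, sY]
  generalize segS (extZ w) 0 m = D at *
  have e1 : revT p (X ^ m * μ) = revT p α := revT_congr _ _ _ hμα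
  have e2 : revT p (X ^ i * (μ * G0)) = revT p (X ^ i * γ₁) := by
    refine revT_congr _ _ _ ?_
    have : X ^ i * (μ * G0) - X ^ i * γ₁ = X ^ i * (μ * (G0 - γ₁ * μ⁻¹)) := by
      linear_combination (X ^ i * γ₁) * hμi
    rw [this, ← hppi]
    exact mul_dvd_mul_left _ (Dvd.dvd.mul_left hG0 _)
  have e3 : revT p (G0 * E0 + X ^ (p - m) * D) = revT p δ := by
    refine revT_congr _ _ _ ?_
    have : G0 * E0 + X ^ (p - m) * D - δ = X ^ (p - m) * (D - D1) := by
      linear_combination -hD1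
    rw [this, ← hppm, mul_comm (X ^ m)]
    exact mul_dvd_mul_left _ sD
  have e4 : revT p (X ^ (m - i) * E0) = revT p (X ^ (m - i) * ε₁) := by
    refine revT_congr _ _ _ ?_
    rw [← mul_sub, ← hpe]
    exact mul_dvd_mul_left _ hE0
  rw [ptOf, ptOf, e1, e2, e3, e4]

end Param

/-- For `Y_p(gl_3)` with `p > 2`, the subvariety `W₁ = ⋃_{s=1}^{p+1} W_{1s}` of `GTs₁`
is equidimensional of dimension `3p`. -/
theorem W1_equidim (k : Type*) [Field k] [IsAlgClosed k] [CharZero k]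
    (p : ℕ) (hp : 2 < p) :
    IsEquidimOfDim k (Fin 3 × Fin 3 × Fin p) (W1 k 3 p) (3 * p) := by
  have hpoly := fun (j : {q : Fin (p + 1) × Fin (p + 1) // q.2 ≤ q.1}) s =>
    phi_poly (k := k) p j.1.1 j.1.2 s
  choose Φ hΦ using hpoly
  have hΦ' : ∀ j w, (fun s => MvPolynomial.eval w (Φ j s)) = phi p j.1.1 j.1.2 w := by
    intro j w
    ext s
    exact (hΦ j s w).symm
  refine equidim_of_param (W1 k 3 p) (3 * p) Φ ?_ ?_ ?_
  · intro j w
    rw [hΦ']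
    exact phi_mem hp _ _ (by omega) j.2 w
  · intro x hx
    obtain ⟨m, α, γ, δ, ε, b, hm, h1, h2, h3, h4, rfl⟩ := exists_ptOf hp x hx
    obtain ⟨i, hi, w, hw⟩ := exists_phi m hm α γ δ ε b h1 h2 h3 h4
    refine ⟨⟨(⟨m, by omega⟩, ⟨i, by omega⟩), hi⟩, w, ?_⟩
    rw [hΦ']
    exact hw
  · intro j i
    obtain ⟨s, c, d, hd, h⟩ := phi_chain (k := k) p j.1.1 j.1.2 (by omega) j.2 i
    refine ⟨s, c, d, hd, fun w hw => ?_⟩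
    rw [← hΦ]
    exact h w hw

end
end
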